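/- Let A = (a₁,…,a_m) with m ≥ 1 and each a_j ≥ 2; set |A| = a₁ + … + a_m. Let Q be the quotient of the chain complex of the simplex on the vertex set V = E₁ ⊔ … ⊔ E_m by the span of the faces S ⊆ V such that, for some j, the graph on N_j with edge set S ∩ E_j is not 2-connected. Then the homology of Q vanishes in every degree other than 2|A| − 3m − 1, and in degree 2|A| − 3m − 1 it is a free abelian group of rank (a₁−2)!·(a₂−2)!·…·(a_m−2)!. -/

import Mathlib

set_option autoImplicit false

/-!
Statement 4: For A = (a₁,…,a_m), m ≥ 1, a_j ≥ 2, the quotient of the chain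
complex of the simplex on E₁ ⊔ … ⊔ E_m by the span of the faces in which some
graph is not 2-connected has homology concentrated in degree 2|A| − 3m − 1,
where it is free abelian of rank (a₁−2)!⋯(a_m−2)!.
-/

noncomputable section

open Finset

/-- Generators of degree `d` of the simplicial chain complex on the vertex set `V`:
`(d+1)`-element subsets of `V`. -/
abbrev Gen (V : Type) (d : ℕ) : Type := {S : Finset V // S.card = d + 1}

/-- The degree-`d` chain group: the free abelian group on the `(d+1)`-element
subsets of `V`. -/
abbrev Chain (V : Type) (d : ℕ) : Type := Gen V d →₀ ℤ

/-- The simplicial boundary operator: `∂S = Σ_m (−1)^{m−1} (S − s_m)`, where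
`s₁ < s₂ < …` are the elements of `S` (the sign of the summand removing `s`
is `(−1)` to the number of elements of `S` smaller than `s`).  In degree `0`
it is the zero map. -/
def bdry (V : Type) [LinearOrder V] (d : ℕ) :
    Chain V d →ₗ[ℤ] Chain V (d - 1) := by
  classical
  exact Finsupp.lift (Chain V (d - 1)) ℤ (Gen V d) fun S =>
    ∑ s ∈ S.1, ((-1 : ℤ) ^ (S.1.filter fun t => t < s).card) •
      (if h : (S.1.erase s).card = (d - 1) + 1
        then Finsupp.single (⟨S.1.erase s, h⟩ : Gen V (d - 1)) (1 : ℤ) else 0)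

/-- The subgroup of degree-`d` chains spanned by the "bad" faces, i.e. those not
satisfying the predicate `good`.  The quotient complex is the quotient of the
chain complex of the simplex by these subgroups. -/
def badChains (V : Type) (good : Finset V → Prop) (d : ℕ) : Submodule ℤ (Chain V d) :=
  Submodule.span ℤ {x | ∃ S : Gen V d, ¬ good S.1 ∧ x = Finsupp.single S 1}

/-- Cycles of degree `d` of the quotient complex: chains whose boundary vanishes
in the quotient, i.e. lies in the span of the bad faces. -/
def cycles (V : Type) [LinearOrder V] (good : Finset V → Prop) (d : ℕ) :
    Submodule ℤ (Chain V d) :=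
  Submodule.comap (bdry V d) (badChains V good (d - 1))

/-- The degree-`d` homology of the quotient complex: cycles modulo
(bad chains + boundaries). -/
abbrev homology (V : Type) [LinearOrder V] (good : Finset V → Prop) (d : ℕ) : Type :=
  (cycles V good d) ⧸ (Submodule.comap (cycles V good d).subtype
    (badChains V good d ⊔ LinearMap.range (bdry V (d + 1))))

/-- Edges of the complete graph on `Fin k`: unordered pairs of distinct nodes,
encoded as ordered pairs `(a, b)` with `a < b`. -/
abbrev Edge (k : ℕ) : Type := {p : Fin k × Fin k // p.1 < p.2}

/-- The lexicographic order on edges induced by the order of the nodes. -/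
instance (k : ℕ) : LinearOrder (Edge k) :=
  LinearOrder.lift' (fun e => toLex e.1) fun a b h => Subtype.ext (toLex.injective h)

/-- The graph on the `k` nodes `Fin k` with the given edge set. -/
def graphOf (k : ℕ) (S : Finset (Edge k)) : SimpleGraph (Fin k) :=
  SimpleGraph.fromEdgeSet {q | ∃ p ∈ S, q = s(p.1.1, p.1.2)}


/-- The vertex set of the simplex: the disjoint union `E₁ ⊔ … ⊔ E_m`, where
`E_j` is the set of all unordered pairs of distinct nodes of the `j`-th node
set `N_j = Fin (A j)`. -/
abbrev VtxE (m : ℕ) (A : Fin m → ℕ) : Type := Σ j : Fin m, Edge (A j)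

/-- The graph on `N_j = Fin (A j)` with edge set `S ∩ E_j`. -/
def grOf (m : ℕ) (A : Fin m → ℕ) (S : Finset (VtxE m A)) (j : Fin m) :
    SimpleGraph (Fin (A j)) :=
  SimpleGraph.fromEdgeSet
    {q : Sym2 (Fin (A j)) |
      ∃ e : Edge (A j), (⟨j, e⟩ : VtxE m A) ∈ S ∧ q = s(e.1.1, e.1.2)}

/-- A face `S` is good iff for every `j` the graph on `N_j` with edge set
`S ∩ E_j` is 2-connected: connected, and still connected on the remaining
nodes after deleting any node together with all incident edges. -/
def goodTwoConn (m : ℕ) (A : Fin m → ℕ) (S : Finset (VtxE m A)) : Prop :=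
  ∀ j : Fin m, (grOf m A S j).Connected ∧
    ∀ v : Fin (A j), ((grOf m A S j).induce {u | u ≠ v}).Connected

section MorseFiltration

variable {E : Type*} [DecidableEq E]

/-- A family of finite sets built up from the top by adding either one critical set of
cardinality `k` or a pair `S, S ∪ {e}`, where no earlier set is contained in a newly added one.
The second index counts the critical sets. -/
inductive MorseFiltration (k : ℕ) : Set (Finset E) → ℕ → Prop
  | empty : MorseFiltration k ∅ 0
  | crit {P : Set (Finset E)} {r : ℕ} {S : Finset E} (hP : MorseFiltration k P r)
      (hS : ∀ T ∈ P, ¬ T ⊆ S) (hk : S.card = k) : MorseFiltration k (insert S P) (r + 1)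
  | pair {P : Set (Finset E)} {r : ℕ} {S : Finset E} {e : E} (hP : MorseFiltration k P r)
      (he : e ∉ S) (hS : ∀ T ∈ P, ¬ T ⊆ insert e S) :
      MorseFiltration k (insert S (insert (insert e S) P)) r

namespace MorseFiltration

theorem union {k : ℕ} {P Q : Set (Finset E)} {r s : ℕ} (hP : MorseFiltration k P r)
    (hQ : MorseFiltration k Q s) (h : ∀ T ∈ P, ∀ S ∈ Q, ¬ T ⊆ S) :
    MorseFiltration k (P ∪ Q) (r + s) := by
  induction hQ with
  | empty => simpa using hP
  | @crit Q s S hQ hS hk ih =>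
    rw [Set.union_insert, ← add_assoc]
    refine crit (ih fun T hT U hU => h T hT U (Set.mem_insert_of_mem _ hU)) ?_ hk
    rintro T (hT | hT)
    · exact h T hT S (Set.mem_insert _ _)
    · exact hS T hT
  | @pair Q s S e hQ he hS ih =>
    rw [Set.union_insert, Set.union_insert]
    refine pair (ih fun T hT U hU => h T hT U (by simp [hU])) he ?_
    rintro T (hT | hT)
    · exact h T hT _ (by simp)
    · exact hS T hT

theorem iUnion {ι : Type*} {k r : ℕ} (s : Finset ι) {P : ι → Set (Finset E)}
    (hP : ∀ i ∈ s, MorseFiltration k (P i) r)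
    (h : ∀ i ∈ s, ∀ j ∈ s, i ≠ j → ∀ T ∈ P i, ∀ S ∈ P j, ¬ T ⊆ S) :
    MorseFiltration k (⋃ i ∈ s, P i) (s.card * r) := by
  classical
  induction s using Finset.induction_on with
  | empty => simpa using empty
  | @insert i s hi ih =>
    rw [Finset.set_biUnion_insert, Finset.card_insert_of_notMem hi, add_mul, one_mul, add_comm]
    refine union (hP i (by simp)) (ih (fun j hj => hP j (by simp [hj]))
      fun j hj l hl => h j (by simp [hj]) l (by simp [hl])) ?_
    intro T hT S hS
    simp only [Set.mem_iUnion] at hS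
    obtain ⟨j, hj, hS⟩ := hS
    exact h i (by simp) j (by simp [hj]) (by rintro rfl; exact hi hj) T hT S hS

theorem image_union {k r : ℕ} {P : Set (Finset E)} (X : Finset E) (hP : MorseFiltration k P r)
    (h : ∀ S ∈ P, Disjoint X S) : MorseFiltration (X.card + k) ((X ∪ ·) '' P) r := by
  have key : ∀ T S : Finset E, Disjoint X T → X ∪ T ⊆ X ∪ S → T ⊆ S := by
    intro T S hT hTS x hx
    have := hTS (mem_union_right X hx)
    have hxX : x ∉ X := fun hX => Finset.disjoint_left.1 hT hX hx
    simpa [hxX] using this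
  induction hP with
  | empty => simpa using empty
  | @crit P s S hP hS hk ih =>
    rw [Set.image_insert_eq]
    refine crit (ih fun T hT => h T (by simp [hT])) ?_ ?_
    · rintro _ ⟨T, hT, rfl⟩ hTS
      exact hS T hT (key T S (h T (by simp [hT])) hTS)
    · rw [card_union_of_disjoint (h S (by simp)), hk]
  | @pair P s S e hP he hS ih =>
    have hX := h (insert e S) (by simp)
    rw [Set.image_insert_eq, Set.image_insert_eq, union_insert]
    refine pair (ih fun T hT => h T (by simp [hT])) ?_ ?_
    · simp only [mem_union, he, or_false]
      exact fun hX' => Finset.disjoint_left.1 hX hX' (by simp)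
    · rintro _ ⟨T, hT, rfl⟩ hTS
      rw [← union_insert] at hTS
      exact hS T hT (key T _ (h T (by simp [hT])) hTS)

/-- Adding below a filtered family a family matched by toggling the element `e S` of `S`,
where `e` is constant on comparable sets with equal value of the monotone function `φ`. -/
theorem union_of_toggle [Finite E] {k r : ℕ} {P : Set (Finset E)} (hP : MorseFiltration k P r)
    (e : Finset E → E) (φ : Finset E → ℕ) (F : Set (Finset E))
    (hPF : ∀ T ∈ P, ∀ S ∈ F, ¬ T ⊆ S)
    (hins : ∀ S ∈ F, insert (e S) S ∈ F ∧ φ (insert (e S) S) = φ S ∧ e (insert (e S) S) = e S)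
    (hers : ∀ S ∈ F, S.erase (e S) ∈ F ∧ φ (S.erase (e S)) = φ S ∧ e (S.erase (e S)) = e S)
    (hφ : ∀ S ∈ F, ∀ T ∈ F, S ⊆ T → φ S ≤ φ T ∧ (φ S = φ T → e S = e T)) :
    MorseFiltration k (P ∪ F) r := by
  induction hn : F.ncard using Nat.strong_induction_on generalizing F with
  | _ n ih =>
  rcases F.eq_empty_or_nonempty with rfl | hne
  · simpa using hP
  obtain ⟨S₀, hS₀, hmin⟩ := Set.exists_min_image F (fun S => toLex (φ S, S.card))
    (Set.toFinite F) hne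
  have hmin : ∀ T ∈ F, φ T ≤ φ S₀ → φ S₀ = φ T ∧ S₀.card ≤ T.card := by
    intro T hT hle
    have := hmin T hT
    rw [Prod.Lex.toLex_le_toLex] at this
    simp only at this
    omega
  have heS : e S₀ ∉ S₀ := by
    intro hmem
    have h1 := hers S₀ hS₀
    have h2 := hmin _ h1.1 h1.2.1.le
    have := Finset.card_erase_lt_of_mem hmem
    omega
  have hT₀ := hins S₀ hS₀
  set e₀ := e S₀ with he₀
  set T₀ := insert e₀ S₀ with hT₀def
  have hbelow : ∀ T ∈ F, T ⊆ T₀ → T = S₀ ∨ T = T₀ := by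
    intro T hT hTT
    have h1 := hφ T hT T₀ hT₀.1 hTT
    have h2 := hmin T hT (h1.1.trans hT₀.2.1.le)
    have h3 : e T = e₀ := by rw [h1.2 (by rw [← h2.1, hT₀.2.1]), hT₀.2.2]
    have h4 := hers T hT
    rw [h3] at h4
    have h5 := hmin _ h4.1 (h4.2.1.trans h2.1.symm).le
    have h6 : T.erase e₀ = S₀ := by
      refine Finset.eq_of_subset_of_card_le ?_ h5.2
      rw [← Finset.erase_insert heS]
      exact Finset.erase_subset_erase _ hTT
    by_cases hmem : e₀ ∈ T
    · right; rw [hT₀def, ← h6, Finset.insert_erase hmem]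
    · left; rw [← h6, Finset.erase_eq_of_notMem hmem]
  have hS₀T₀ : S₀ ≠ T₀ := fun h => heS (h ▸ Finset.mem_insert_self _ _)
  have hers' : T₀.erase e₀ = S₀ := Finset.erase_insert heS
  set F' := F \ {S₀, T₀} with hF'
  have hF'F : F' ⊆ F := Set.sdiff_subset
  have hmem : ∀ T, T ∈ F' ↔ T ∈ F ∧ T ≠ S₀ ∧ T ≠ T₀ := by
    intro T; simp [hF']
  have key : MorseFiltration k (P ∪ F') r := by
    refine ih F'.ncard ?_ F' (fun T hT S hS => hPF T hT S (hF'F hS)) ?_ ?_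
      (fun S hS T hT => hφ S (hF'F hS) T (hF'F hT)) rfl
    · rw [← hn]
      refine Set.ncard_lt_ncard ⟨hF'F, fun h => ?_⟩ (Set.toFinite F)
      exact ((hmem _).1 (h hS₀)).2.1 rfl
    · intro S hS
      obtain ⟨hSF, hS1, hS2⟩ := (hmem S).1 hS
      have h1 := hins S hSF
      refine ⟨(hmem _).2 ⟨h1.1, ?_, ?_⟩, h1.2⟩
      · intro h
        rw [h] at h1
        exact heS (by rw [he₀, h1.2.2, ← h]; exact Finset.mem_insert_self _ _)
      · intro h
        rcases hbelow S hSF (h ▸ Finset.subset_insert _ _) with h' | h'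
        · exact hS1 h'
        · exact hS2 h'
    · intro S hS
      obtain ⟨hSF, hS1, hS2⟩ := (hmem S).1 hS
      have h1 := hers S hSF
      have h2 : ∀ U, S.erase (e S) = U → (U = S₀ ∨ U = T₀) → False := by
        intro U hU hU'
        rw [hU] at h1
        have h3 : e S = e₀ := by
          rcases hU' with rfl | rfl
          · exact h1.2.2.symm
          · rw [← h1.2.2, hT₀.2.2]
        by_cases hm : e S ∈ S
        · have h4 : S = T₀ := by
            rw [← Finset.insert_erase hm, hU, h3]
            rcases hU' with rfl | rfl
            · rfl
            · simp [hT₀def]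
          exact hS2 h4
        · rw [Finset.erase_eq_of_notMem hm] at hU
          rcases hU' with h | h
          · exact hS1 (hU.trans h)
          · exact hS2 (hU.trans h)
      exact ⟨(hmem _).2 ⟨h1.1, fun h => h2 _ h (.inl rfl), fun h => h2 _ h (.inr rfl)⟩, h1.2⟩
  have : P ∪ F = insert S₀ (insert T₀ (P ∪ F')) := by
    ext T
    simp only [Set.mem_union, Set.mem_insert_iff, hmem]
    by_cases h1 : T = S₀
    · simp [h1, hS₀]
    · by_cases h2 : T = T₀
      · simp [h2, hT₀.1]
      · simp [h1, h2]
  rw [this]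
  refine pair key heS ?_
  rintro T (hT | hT) hTT
  · exact hPF T hT T₀ hT₀.1 hTT
  · obtain ⟨hTF, h1, h2⟩ := (hmem T).1 hT
    rcases hbelow T hTF hTT with h | h
    · exact h1 h
    · exact h2 h

theorem preimage_map {D : Type*} [DecidableEq D] (f : D ↪ E) {k r : ℕ} {P : Set (Finset E)}
    (hP : MorseFiltration k P r) (h : ∀ S ∈ P, ∃ S' : Finset D, S'.map f = S) :
    MorseFiltration k {S : Finset D | S.map f ∈ P} r := by
  induction hP with
  | empty => simpa using empty
  | @crit P s S hP hS hk ih =>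
    obtain ⟨S', rfl⟩ := h S (by simp)
    have : {T : Finset D | T.map f ∈ insert (S'.map f) P} =
        insert S' {T : Finset D | T.map f ∈ P} := by
      ext T; simp
    rw [this]
    refine crit (ih fun T hT => h T (by simp [hT])) ?_ (by simpa using hk)
    intro T hT hTS
    exact hS _ hT (Finset.map_subset_map.2 hTS)
  | @pair P s S e hP he hS ih =>
    obtain ⟨S', rfl⟩ := h S (by simp)
    obtain ⟨T', hT'⟩ := h (insert e (S'.map f)) (by simp)
    obtain ⟨d, -, rfl⟩ : ∃ d ∈ T', f d = e := by
      have : e ∈ T'.map f := by rw [hT']; simp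
      simpa using this
    have hd : d ∉ S' := fun hd => he (by simpa using hd)
    have : {T : Finset D | T.map f ∈ insert (S'.map f) (insert (insert (f d) (S'.map f)) P)} =
        insert S' (insert (insert d S') {T : Finset D | T.map f ∈ P}) := by
      ext T
      simp only [← Finset.map_insert, Set.mem_ofPred_eq, Set.mem_insert_iff, Finset.map_inj]
    rw [this]
    refine pair (ih fun T hT => h T (by simp [hT])) hd ?_
    intro T hT hTS
    refine hS _ hT ?_
    rw [← Finset.map_insert]
    exact Finset.map_subset_map.2 hTS

end MorseFiltration

end MorseFiltration

section SetChains

variable {V : Type} [Fintype V] [LinearOrder V]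

/-- The boundary operator on integer functions on all finite subsets of `V`. -/
def setBdry : (Finset V → ℤ) →ₗ[ℤ] (Finset V → ℤ) where
  toFun c T := ∑ s ∈ Tᶜ, (-1) ^ (T.filter (· < s)).card * c (insert s T)
  map_add' c d := by
    ext T
    simp [mul_add, Finset.sum_add_distrib]
  map_smul' a c := by
    ext T
    simp [Finset.mul_sum, mul_left_comm]

theorem setBdry_apply (c : Finset V → ℤ) (T : Finset V) :
    setBdry c T = ∑ s ∈ Tᶜ, (-1) ^ (T.filter (· < s)).card * c (insert s T) := rfl

theorem setBdry_setBdry (c : Finset V → ℤ) : setBdry (setBdry c) = 0 := by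
  ext T
  set f : V → V → ℤ := fun s t => if s ∈ Tᶜ ∧ t ∈ Tᶜ ∧ t ≠ s then
    (-1) ^ (T.filter (· < s)).card * ((-1) ^ ((insert s T).filter (· < t)).card *
      c (insert t (insert s T))) else 0 with hf
  have h1 : setBdry (setBdry c) T = ∑ s, ∑ t, f s t := by
    rw [setBdry_apply, ← Finset.sum_subset (Finset.subset_univ Tᶜ)]
    · refine Finset.sum_congr rfl fun s hs => ?_
      rw [setBdry_apply, Finset.mul_sum, ← Finset.sum_subset (Finset.subset_univ (insert s T)ᶜ)]
      · refine Finset.sum_congr rfl fun t ht => ?_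
        simp only [Finset.mem_compl, Finset.mem_insert, not_or] at hs ht
        simp [hf, hs, ht]
      · intro t _ ht
        simp only [Finset.mem_compl, Finset.mem_insert, not_not] at ht
        simp only [hf, Finset.mem_compl]
        rw [if_neg]
        tauto
    · intro s _ hs
      have hsT : s ∈ T := by simpa using hs
      simp [hf, hsT]
  have h2 : ∀ s t, f s t = - f t s := by
    intro s t
    simp only [hf]
    by_cases h : s ∈ Tᶜ ∧ t ∈ Tᶜ ∧ t ≠ s
    · rw [if_pos h, if_pos ⟨h.2.1, h.1, h.2.2.symm⟩, Finset.insert_comm t s T]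
      obtain ⟨hs, ht, hne⟩ := h
      simp only [Finset.mem_compl] at hs ht
      rw [Finset.filter_insert, Finset.filter_insert]
      rcases lt_or_gt_of_ne hne with hlt | hlt
      · rw [if_neg hlt.not_gt, if_pos hlt, Finset.card_insert_of_notMem (by simp [ht])]
        ring
      · rw [if_pos hlt, if_neg hlt.not_gt, Finset.card_insert_of_notMem (by simp [hs])]
        ring
    · rw [if_neg h, if_neg (by tauto), neg_zero]
  have h3 : ∑ s, ∑ t, f s t = - ∑ s, ∑ t, f s t := by
    conv_rhs => rw [Finset.sum_comm]
    simp only [← Finset.sum_neg_distrib]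
    exact Finset.sum_congr rfl fun s _ => Finset.sum_congr rfl fun t _ => h2 s t
  rw [h1, Pi.zero_apply]
  omega

/-- The functions supported on the subsets of cardinality `d`. -/
def homogeneous (V : Type) (d : ℕ) : Submodule ℤ (Finset V → ℤ) where
  carrier := {c | ∀ T, T.card ≠ d → c T = 0}
  add_mem' hc hd T hT := by simp [hc T hT, hd T hT]
  zero_mem' _ _ := rfl
  smul_mem' a c hc T hT := by simp [hc T hT]

/-- The functions vanishing on the family `P`. -/
def vanishing (P : Set (Finset V)) : Submodule ℤ (Finset V → ℤ) where
  carrier := {c | ∀ T ∈ P, c T = 0}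
  add_mem' hc hd T hT := by simp [hc T hT, hd T hT]
  zero_mem' _ _ := rfl
  smul_mem' a c hc T hT := by simp [hc T hT]

theorem setBdry_mem_homogeneous {d : ℕ} {c : Finset V → ℤ} (hc : c ∈ homogeneous V (d + 1)) :
    setBdry c ∈ homogeneous V d := by
  intro T hT
  rw [setBdry_apply]
  refine Finset.sum_eq_zero fun s hs => ?_
  rw [hc, mul_zero]
  rw [Finset.card_insert_of_notMem (by simpa using hs)]
  omega

theorem setBdry_apply_eq_zero {d : ℕ} {c : Finset V → ℤ} (hc : c ∈ homogeneous V d)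
    {T : Finset V} (hT : T.card + 1 ≠ d) : setBdry c T = 0 := by
  rw [setBdry_apply]
  refine Finset.sum_eq_zero fun s hs => ?_
  rw [hc, mul_zero]
  rwa [Finset.card_insert_of_notMem (by simpa using hs)]

theorem single_mem_homogeneous (S : Finset V) (a : ℤ) :
    Pi.single S a ∈ homogeneous V S.card := by
  intro T hT
  rw [Pi.single_eq_of_ne]
  rintro rfl
  exact hT rfl

theorem setBdry_single_apply_of_not_subset (S : Finset V) (a : ℤ) {T : Finset V}
    (hT : ¬ T ⊆ S) : setBdry (Pi.single S a) T = 0 := by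
  rw [setBdry_apply]
  refine Finset.sum_eq_zero fun s _ => ?_
  rw [Pi.single_eq_of_ne, mul_zero]
  rintro rfl
  exact hT (Finset.subset_insert _ _)

theorem setBdry_single_insert (S : Finset V) {e : V} (he : e ∉ S) (a : ℤ) :
    setBdry (Pi.single (insert e S) a) S = (-1) ^ (S.filter (· < e)).card * a := by
  rw [setBdry_apply, Finset.sum_eq_single e]
  · simp
  · intro s hs hse
    rw [Pi.single_eq_of_ne, mul_zero]
    intro h
    have : s ∈ insert e S := h ▸ Finset.mem_insert_self _ _
    simp only [Finset.mem_insert, hse, false_or] at this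
    exact (Finset.mem_compl.1 hs) this
  · intro h
    simp [he] at h

theorem setBdry_single_self (S : Finset V) (a : ℤ) : setBdry (Pi.single S a) S = 0 :=
  setBdry_apply_eq_zero (single_mem_homogeneous S a) (by omega)

theorem setBdry_apply_eq_zero_of_insert {P : Set (Finset V)} {c : Finset V → ℤ}
    (hc : c ∈ vanishing P) {S : Finset V} (h : ∀ s ∉ S, insert s S ∈ P) : setBdry c S = 0 := by
  rw [setBdry_apply]
  refine Finset.sum_eq_zero fun s hs => ?_
  rw [hc _ (h s (by simpa using hs)), mul_zero]

theorem setBdry_apply_of_insert {P : Set (Finset V)} {c : Finset V → ℤ}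
    (hc : c ∈ vanishing P) {S : Finset V} {e : V} (he : e ∉ S)
    (h : ∀ s ∉ S, s ≠ e → insert s S ∈ P) :
    setBdry c S = (-1) ^ (S.filter (· < e)).card * c (insert e S) := by
  rw [setBdry_apply, Finset.sum_eq_single e]
  · intro s hs hse
    rw [hc _ (h s (by simpa using hs) hse), mul_zero]
  · intro h
    simp [he] at h

/-- The chains modulo those vanishing on `P` have homology only in cardinality `k`, where it is
free of rank `r`. -/
structure IsSpherical (P : Set (Finset V)) (k r : ℕ) : Prop where
  exact_of_ne : ∀ d ≠ k, ∀ c ∈ homogeneous V d, setBdry c ∈ vanishing P →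
    ∃ b ∈ homogeneous V (d + 1), c - setBdry b ∈ vanishing P
  exists_basis : ∃ z : Fin r → Finset V → ℤ,
    (∀ i, z i ∈ homogeneous V k) ∧ (∀ i, setBdry (z i) ∈ vanishing P) ∧
    (∀ c ∈ homogeneous V k, setBdry c ∈ vanishing P →
      ∃ a : Fin r → ℤ, ∃ b ∈ homogeneous V (k + 1),
        c - ∑ i, a i • z i - setBdry b ∈ vanishing P) ∧
    (∀ a : Fin r → ℤ, ∀ b ∈ homogeneous V (k + 1),
      ∑ i, a i • z i - setBdry b ∈ vanishing P → a = 0)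

theorem isSpherical_empty (k : ℕ) : IsSpherical (∅ : Set (Finset V)) k 0 where
  exact_of_ne _ _ _ _ _ := ⟨0, zero_mem _, fun _ h => h.elim⟩
  exists_basis := ⟨fun i => i.elim0, fun i => i.elim0, fun i => i.elim0,
    fun _ _ _ => ⟨0, 0, zero_mem _, fun _ h => h.elim⟩, fun _ _ _ _ => Subsingleton.elim _ _⟩

theorem mem_vanishing_insert {P : Set (Finset V)} {S : Finset V} {c : Finset V → ℤ} :
    c ∈ vanishing (insert S P) ↔ c S = 0 ∧ c ∈ vanishing P :=
  Set.forall_mem_insert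

theorem insert_mem_of_isUpperSet_insert {P : Set (Finset V)} {S : Finset V}
    (h : IsUpperSet (insert S P)) {s : V} (hs : s ∉ S) : insert s S ∈ P := by
  rcases h (Finset.subset_insert s S) (Set.mem_insert _ _) with h' | h'
  · exact absurd (h' ▸ Finset.mem_insert_self _ _) hs
  · exact h'

theorem IsSpherical.insert_crit {P : Set (Finset V)} {k r : ℕ} (hP : IsSpherical P k r)
    {S : Finset V} (hS : ∀ T ∈ P, ¬ T ⊆ S) (hk : S.card = k) (hup : IsUpperSet (insert S P)) :
    IsSpherical (insert S P) k (r + 1) where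
  exact_of_ne d hd c hc hcyc := by
    obtain ⟨b, hb, hcb⟩ := hP.exact_of_ne d hd c hc (mem_vanishing_insert.1 hcyc).2
    refine ⟨b, hb, mem_vanishing_insert.2 ⟨?_, hcb⟩⟩
    exact sub_mem hc (setBdry_mem_homogeneous hb) S (by omega)
  exists_basis := by
    obtain ⟨z, hz, hzc, hgen, hind⟩ := hP.exists_basis
    have hSS : (Pi.single S 1 : Finset V → ℤ) ∈ vanishing P := by
      intro T hT
      rw [Pi.single_eq_of_ne]
      rintro rfl
      exact hS T hT subset_rfl
    refine ⟨Fin.cons (Pi.single S 1) z, ?_, ?_, ?_, ?_⟩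
    · refine Fin.cases ?_ ?_
      · simpa [hk] using single_mem_homogeneous S 1
      · simpa using hz
    · refine Fin.cases ?_ ?_
      · rw [Fin.cons_zero, mem_vanishing_insert]
        exact ⟨setBdry_single_self S 1,
          fun T hT => setBdry_single_apply_of_not_subset S 1 (hS T hT)⟩
      · intro i
        rw [Fin.cons_succ, mem_vanishing_insert]
        exact ⟨setBdry_apply_eq_zero (hz i) (by omega), hzc i⟩
    · intro c hc hcyc
      obtain ⟨a, b, hb, hab⟩ := hgen c hc (mem_vanishing_insert.1 hcyc).2
      set x := c - ∑ i, a i • z i - setBdry b with hx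
      have hrw : c - ∑ i, (Fin.cons (x S) a : Fin (r + 1) → ℤ) i •
          (Fin.cons (Pi.single S 1) z : Fin (r + 1) → Finset V → ℤ) i - setBdry b =
          x - x S • Pi.single S 1 := by
        rw [Fin.sum_univ_succ]
        simp only [Fin.cons_zero, Fin.cons_succ]
        rw [hx]
        abel
      refine ⟨Fin.cons (x S) a, b, hb, ?_⟩
      rw [hrw, mem_vanishing_insert]
      exact ⟨by simp, sub_mem hab ((vanishing P).smul_mem _ hSS)⟩
    · intro a b hb hab
      rw [Fin.sum_univ_succ] at hab
      simp only [Fin.cons_zero, Fin.cons_succ] at hab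
      rw [mem_vanishing_insert] at hab
      have h1 : (fun i : Fin r => a i.succ) = 0 := by
        refine hind _ b hb ?_
        have := sub_mem hab.2 ((vanishing P).smul_mem (a 0) hSS)
        convert this using 1
        abel
      have h2 : ∀ i : Fin r, a i.succ = 0 := fun i => congrFun h1 i
      simp only [h2, zero_smul, Finset.sum_const_zero, add_zero] at hab
      have h3 : setBdry b ∈ vanishing P := by
        have := sub_mem ((vanishing P).smul_mem (a 0) hSS) hab.2
        simpa using this
      obtain ⟨b', hb', hbb⟩ := hP.exact_of_ne (k + 1) (by omega) b hb h3
      have h4 := setBdry_apply_eq_zero_of_insert hbb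
        fun s hs => insert_mem_of_isUpperSet_insert hup hs
      rw [map_sub, setBdry_setBdry, sub_zero] at h4
      have h5 : a 0 = 0 := by simpa [h4] using hab.1
      ext i
      refine Fin.cases h5 h2 i

theorem IsSpherical.insert_pair {P : Set (Finset V)} {k r : ℕ} (hP : IsSpherical P k r)
    {S : Finset V} {e : V} (he : e ∉ S) (hS : ∀ T ∈ P, ¬ T ⊆ insert e S)
    (hup : IsUpperSet (insert S (insert (insert e S) P))) :
    IsSpherical (insert S (insert (insert e S) P)) k r := by
  set P' := insert S (insert (insert e S) P) with hP'
  have hmem : ∀ c, c ∈ vanishing P' ↔ c S = 0 ∧ c (insert e S) = 0 ∧ c ∈ vanishing P := by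
    intro c
    rw [hP', mem_vanishing_insert, mem_vanishing_insert]
  have hinsS : ∀ s ∉ S, s ≠ e → insert s S ∈ P := by
    intro s hs hse
    rcases insert_mem_of_isUpperSet_insert hup hs with h | h
    · have : s ∈ insert e S := h ▸ Finset.mem_insert_self _ _
      simp [hs, hse] at this
    · exact h
  have hcard : (insert e S).card = S.card + 1 := Finset.card_insert_of_notMem he
  have hsgn : ∀ x : ℤ, (-1) ^ (S.filter (· < e)).card * ((-1) ^ (S.filter (· < e)).card * x) = x := by
    intro x
    rw [← mul_assoc, ← mul_pow]
    simp
  have hsingle : ∀ a : ℤ, Pi.single (insert e S) a ∈ vanishing P := by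
    intro a T hT
    rw [Pi.single_eq_of_ne]
    rintro rfl
    exact hS _ hT subset_rfl
  have hbsingle : ∀ a : ℤ, setBdry (Pi.single (insert e S) a) ∈ vanishing P :=
    fun a T hT => setBdry_single_apply_of_not_subset _ _ (hS T hT)
  have hzero : ∀ c ∈ vanishing P, setBdry c S = 0 → c (insert e S) = 0 := by
    intro c hc hcS
    rw [setBdry_apply_of_insert hc he hinsS] at hcS
    rw [← hsgn (c (insert e S)), hcS, mul_zero]
  have hfill : ∀ d, ∀ c ∈ homogeneous V d, c ∈ vanishing P → setBdry c ∈ vanishing P' →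
      ∃ b ∈ homogeneous V (d + 1), c - setBdry b ∈ vanishing P' := by
    intro d c hc hcP hcyc
    have hcT := hzero c hcP ((hmem _).1 hcyc).1
    by_cases hd : S.card = d
    · refine ⟨Pi.single (insert e S) ((-1) ^ (S.filter (· < e)).card * c S), ?_, ?_⟩
      · rw [← hd, ← hcard]
        exact single_mem_homogeneous _ _
      · rw [hmem]
        refine ⟨?_, ?_, sub_mem hcP (hbsingle _)⟩
        · rw [Pi.sub_apply, setBdry_single_insert S he, hsgn, sub_self]
        · rw [Pi.sub_apply, setBdry_single_self, hcT, sub_zero]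
    · refine ⟨0, zero_mem _, ?_⟩
      rw [map_zero, sub_zero, hmem]
      exact ⟨hc S hd, hcT, hcP⟩
  have hlift : ∀ c ∈ homogeneous V k, setBdry c ∈ vanishing P →
      ∃ c' ∈ homogeneous V k, setBdry c' ∈ vanishing P' ∧ c' - c ∈ vanishing P := by
    intro c hc hcyc
    have hcT : setBdry c (insert e S) = 0 := hzero _ hcyc (by rw [setBdry_setBdry]; rfl)
    by_cases hk : S.card + 1 = k
    · set a : ℤ := (-1) ^ (S.filter (· < e)).card * setBdry c S with ha
      refine ⟨c - Pi.single (insert e S) a, sub_mem hc ?_, ?_, ?_⟩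
      · rw [← hk, ← hcard]
        exact single_mem_homogeneous _ _
      · rw [map_sub, hmem]
        refine ⟨?_, ?_, sub_mem hcyc (hbsingle a)⟩
        · rw [Pi.sub_apply, setBdry_single_insert S he, ha, hsgn, sub_self]
        · rw [Pi.sub_apply, setBdry_single_self, hcT, sub_zero]
      · have := neg_mem (hsingle a)
        convert this using 1
        abel
    · refine ⟨c, hc, (hmem _).2 ⟨setBdry_apply_eq_zero hc hk, hcT, hcyc⟩, ?_⟩
      rw [sub_self]
      exact zero_mem _
  refine ⟨?_, ?_⟩
  · intro d hd c hc hcyc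
    obtain ⟨b, hb, hcb⟩ := hP.exact_of_ne d hd c hc ((hmem _).1 hcyc).2.2
    obtain ⟨b', hb', hcb'⟩ := hfill d _ (sub_mem hc (setBdry_mem_homogeneous hb)) hcb
      (by rwa [map_sub, setBdry_setBdry, sub_zero])
    refine ⟨b + b', add_mem hb hb', ?_⟩
    rwa [map_add, ← sub_sub]
  · obtain ⟨z, hz, hzc, hgen, hind⟩ := hP.exists_basis
    choose z' hz' hzc' hdiff using fun i => hlift (z i) (hz i) (hzc i)
    have hsum : ∀ a : Fin r → ℤ, ∑ i, a i • z' i - ∑ i, a i • z i ∈ vanishing P := by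
      intro a
      rw [← Finset.sum_sub_distrib]
      refine sum_mem fun i _ => ?_
      rw [← smul_sub]
      exact (vanishing P).smul_mem _ (hdiff i)
    refine ⟨z', hz', hzc', ?_, ?_⟩
    · intro c hc hcyc
      obtain ⟨a, b, hb, hab⟩ := hgen c hc ((hmem _).1 hcyc).2.2
      obtain ⟨b', hb', hcb'⟩ := hfill k (c - ∑ i, a i • z' i - setBdry b)
        (sub_mem (sub_mem hc (sum_mem fun i _ => (homogeneous V k).smul_mem _ (hz' i)))
          (setBdry_mem_homogeneous hb))
        (by
          have := sub_mem hab (hsum a)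
          convert this using 1
          abel)
        (by
          rw [map_sub, map_sub, setBdry_setBdry, sub_zero, map_sum]
          refine sub_mem hcyc (sum_mem fun i _ => ?_)
          rw [map_smul]
          exact (vanishing P').smul_mem _ (hzc' i))
      refine ⟨a, b + b', add_mem hb hb', ?_⟩
      rwa [map_add, ← sub_sub]
    · intro a b hb hab
      refine hind a b hb ?_
      have := sub_mem ((hmem _).1 hab).2.2 (hsum a)
      convert this using 1
      abel

theorem MorseFiltration.isSpherical {P : Set (Finset V)} {k r : ℕ} (hP : MorseFiltration k P r)
    (hup : IsUpperSet P) : IsSpherical P k r := by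
  induction hP with
  | empty => exact isSpherical_empty k
  | @crit P r S hP hS hk ih =>
    refine IsSpherical.insert_crit (ih ?_) hS hk hup
    intro T T' hTT hT
    rcases hup hTT (Set.mem_insert_of_mem _ hT) with rfl | h
    · exact absurd hTT (hS T hT)
    · exact h
  | @pair P r S e hP he hS ih =>
    refine IsSpherical.insert_pair (ih ?_) he hS hup
    intro T T' hTT hT
    rcases hup hTT (Set.mem_insert_of_mem _ (Set.mem_insert_of_mem _ hT)) with rfl | rfl | h
    · exact absurd (hTT.trans (Finset.subset_insert _ _)) (hS T hT)
    · exact absurd hTT (hS T hT)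
    · exact h

end SetChains

section ChainFun

variable {V : Type}

/-- A simplicial chain of degree `d` as a function on all finite subsets. -/
def chainFun (d : ℕ) : Chain V d →ₗ[ℤ] (Finset V → ℤ) where
  toFun x T := if h : T.card = d + 1 then x ⟨T, h⟩ else 0
  map_add' x y := by
    ext T
    by_cases h : T.card = d + 1 <;> simp [h]
  map_smul' a x := by
    ext T
    by_cases h : T.card = d + 1 <;> simp [h]

theorem chainFun_apply_of_card {d : ℕ} (x : Chain V d) (S : Gen V d) :
    chainFun d x S.1 = x S :=
  dif_pos S.2

theorem chainFun_mem_homogeneous {d : ℕ} (x : Chain V d) :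
    chainFun d x ∈ homogeneous V (d + 1) :=
  fun _ hT => dif_neg hT

theorem exists_chainFun_eq [Finite V] {d : ℕ} {c : Finset V → ℤ}
    (hc : c ∈ homogeneous V (d + 1)) : ∃ x : Chain V d, chainFun d x = c := by
  refine ⟨Finsupp.equivFunOnFinite.symm fun S => c S.1, ?_⟩
  ext T
  by_cases h : T.card = d + 1
  · exact chainFun_apply_of_card _ ⟨T, h⟩
  · rw [hc T h]
    exact dif_neg h

theorem chainFun_single [DecidableEq V] {d : ℕ} (S : Gen V d) (a : ℤ) :
    chainFun d (Finsupp.single S a) = Pi.single S.1 a := by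
  ext T
  by_cases h : T.card = d + 1
  · rw [chainFun_apply_of_card _ ⟨T, h⟩]
    by_cases hS : T = S.1
    · subst hS
      simp
    · rw [Pi.single_eq_of_ne hS, Finsupp.single_eq_of_ne]
      rintro rfl
      exact hS rfl
  · rw [Pi.single_eq_of_ne]
    · exact dif_neg h
    · rintro rfl
      exact h S.2

theorem mem_badChains_iff {good : Finset V → Prop} {d : ℕ} {x : Chain V d} :
    x ∈ badChains V good d ↔ chainFun d x ∈ vanishing {S | good S} := by
  have h : badChains V good d = Finsupp.supported ℤ ℤ {S : Gen V d | ¬ good S.1} := by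
    rw [badChains, Finsupp.supported_eq_span_single]
    refine congrArg (Submodule.span ℤ) ?_
    ext y
    constructor
    · rintro ⟨S, hS, rfl⟩
      exact ⟨S, hS, rfl⟩
    · rintro ⟨S, hS, rfl⟩
      exact ⟨S, hS, rfl⟩
  rw [h, Finsupp.mem_supported']
  constructor
  · intro hx T hT
    by_cases hc : T.card = d + 1
    · rw [chainFun_apply_of_card _ ⟨T, hc⟩]
      exact hx ⟨T, hc⟩ (not_not.2 hT)
    · exact dif_neg hc
  · intro hx S hS
    rw [← chainFun_apply_of_card]
    exact hx S.1 (not_not.1 hS)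

theorem chainFun_bdry_apply [Fintype V] [LinearOrder V] {d : ℕ} (x : Chain V d) {T : Finset V}
    (hT : T.Nonempty) : chainFun (d - 1) (bdry V d x) T = setBdry (chainFun d x) T := by
  classical
  induction x using Finsupp.induction_linear with
  | zero => simp
  | add x y hx hy => simp only [map_add, Pi.add_apply, hx, hy]
  | single S a =>
    have hterm : ∀ s ∈ S.1, ∀ b : ℤ, chainFun (d - 1)
        (b • (if h : (S.1.erase s).card = (d - 1) + 1
          then Finsupp.single (⟨S.1.erase s, h⟩ : Gen V (d - 1)) (1 : ℤ) else 0)) T =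
        if S.1.erase s = T then b else 0 := by
      intro s hs b
      split_ifs with h1 h2 h2
      · rw [map_smul, chainFun_single, ← h2]
        simp
      · rw [map_smul, chainFun_single, Pi.smul_apply, Pi.single_eq_of_ne (Ne.symm h2), smul_zero]
      · exfalso
        have := Finset.card_erase_of_mem hs
        have := S.2
        have := hT.card_pos
        rw [← h2] at this
        omega
      · simp
    have hL : chainFun (d - 1) (bdry V d (Finsupp.single S a)) T =
        a * ∑ s ∈ S.1, if S.1.erase s = T then
          (-1 : ℤ) ^ (S.1.filter fun t => t < s).card else 0 := by
      rw [bdry]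
      simp only [Finsupp.lift_apply, Finsupp.sum_single_index, zero_smul]
      rw [map_smul, Pi.smul_apply, map_sum, Finset.sum_apply, smul_eq_mul]
      congr 1
      refine Finset.sum_congr rfl fun s hs => ?_
      convert hterm s hs _
    rw [hL, chainFun_single]
    by_cases hST : ∃ s ∈ S.1, S.1.erase s = T
    · obtain ⟨s, hs, rfl⟩ := hST
      have h1 : insert s (S.1.erase s) = S.1 := Finset.insert_erase hs
      have h2 := setBdry_single_insert (S.1.erase s) (Finset.notMem_erase s S.1) a
      rw [h1] at h2
      rw [h2, Finset.sum_eq_single s, if_pos rfl, mul_comm]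
      · congr 3
        ext t
        simp only [Finset.mem_filter, Finset.mem_erase]
        constructor
        · rintro ⟨h, h'⟩
          exact ⟨⟨h'.ne, h⟩, h'⟩
        · rintro ⟨⟨-, h⟩, h'⟩
          exact ⟨h, h'⟩
      · intro t ht hts
        rw [if_neg]
        intro h
        have : t ∈ S.1.erase s := Finset.mem_erase.2 ⟨hts, ht⟩
        rw [← h] at this
        exact Finset.notMem_erase _ _ this
      · exact fun h => absurd hs h
    · push Not at hST
      rw [Finset.sum_eq_zero fun s hs => if_neg (hST s hs), mul_zero, setBdry_apply]
      symm
      refine Finset.sum_eq_zero fun s hs => ?_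
      rw [Pi.single_eq_of_ne, mul_zero]
      intro h
      refine hST s (h ▸ Finset.mem_insert_self _ _) ?_
      rw [← h, Finset.erase_insert (by simpa using hs)]

variable [Fintype V] [LinearOrder V] {good : Finset V → Prop}

theorem mem_cycles_iff (h0 : ¬ good ∅) {d : ℕ} {x : Chain V d} :
    x ∈ cycles V good d ↔ setBdry (chainFun d x) ∈ vanishing {S | good S} := by
  rw [cycles, Submodule.mem_comap, mem_badChains_iff]
  refine forall₂_congr fun T hT => ?_
  rw [chainFun_bdry_apply x]
  rw [Finset.nonempty_iff_ne_empty]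
  rintro rfl
  exact h0 hT

theorem mem_badChains_sup_range_iff (h0 : ¬ good ∅) {d : ℕ} {x : Chain V d} :
    x ∈ badChains V good d ⊔ LinearMap.range (bdry V (d + 1)) ↔
      ∃ b ∈ homogeneous V (d + 2), chainFun d x - setBdry b ∈ vanishing {S | good S} := by
  have key : ∀ (y : Chain V (d + 1)) (w : Chain V d), bdry V (d + 1) y = w →
      (x - w ∈ badChains V good d ↔
        chainFun d x - setBdry (chainFun (d + 1) y) ∈ vanishing {S | good S}) := by
    rintro y w rfl
    rw [mem_badChains_iff, map_sub]
    refine forall₂_congr fun T hT => ?_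
    have := chainFun_bdry_apply (d := d + 1) y (T := T) (by
      rw [Finset.nonempty_iff_ne_empty]
      rintro rfl
      exact h0 hT)
    rw [Pi.sub_apply, Pi.sub_apply, ← this]
    rfl
  constructor
  · intro hx
    obtain ⟨u, hu, v, ⟨y, rfl⟩, rfl⟩ := Submodule.mem_sup.1 hx
    exact ⟨chainFun (d + 1) y, chainFun_mem_homogeneous y, (key y _ rfl).1 (by simpa using hu)⟩
  · rintro ⟨b, hb, hxb⟩
    obtain ⟨y, rfl⟩ := exists_chainFun_eq hb
    exact Submodule.mem_sup.2 ⟨_, (key y _ rfl).2 hxb, _, ⟨y, rfl⟩, sub_add_cancel _ _⟩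

theorem IsSpherical.homology {k r : ℕ} (h : IsSpherical {S | good S} (k + 1) r)
    (h0 : ¬ good ∅) :
    (∀ d ≠ k, Subsingleton (homology V good d)) ∧
      Nonempty (homology V good k ≃ₗ[ℤ] (Fin r → ℤ)) := by
  constructor
  · intro d hd
    rw [Submodule.Quotient.subsingleton_iff, eq_top_iff]
    rintro ⟨x, hx⟩ -
    rw [Submodule.mem_comap, Submodule.subtype_apply, mem_badChains_sup_range_iff h0]
    exact h.exact_of_ne (d + 1) (by omega) _ (chainFun_mem_homogeneous x)
      ((mem_cycles_iff h0).1 hx)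
  · obtain ⟨z, hz, hzc, hgen, hind⟩ := h.exists_basis
    choose y hy using fun i => exists_chainFun_eq (hz i)
    have hyc : ∀ i, y i ∈ cycles V good k := fun i => by
      rw [mem_cycles_iff h0, hy]
      exact hzc i
    set B := Submodule.comap (cycles V good k).subtype
      (badChains V good k ⊔ LinearMap.range (bdry V (k + 1)))
    set f : (Fin r → ℤ) →ₗ[ℤ] cycles V good k :=
      Fintype.linearCombination ℤ fun i => (⟨y i, hyc i⟩ : cycles V good k) with hf
    have hfa : ∀ a, chainFun k (f a : Chain V k) = ∑ i, a i • z i := by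
      intro a
      simp [hf, Fintype.linearCombination_apply, hy]
    refine ⟨(LinearEquiv.ofBijective (B.mkQ ∘ₗ f) ⟨?_, ?_⟩).symm⟩
    · rw [← LinearMap.ker_eq_bot, eq_bot_iff]
      intro a ha
      rw [LinearMap.mem_ker, LinearMap.comp_apply, Submodule.mkQ_apply,
        Submodule.Quotient.mk_eq_zero, Submodule.mem_comap, Submodule.subtype_apply,
        mem_badChains_sup_range_iff h0, hfa] at ha
      obtain ⟨b, hb, hab⟩ := ha
      exact hind a b hb hab
    · intro q
      obtain ⟨⟨x, hx⟩, rfl⟩ := Submodule.Quotient.mk_surjective _ q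
      obtain ⟨a, b, hb, hab⟩ := hgen _ (chainFun_mem_homogeneous x) ((mem_cycles_iff h0).1 hx)
      refine ⟨a, Eq.symm ?_⟩
      rw [LinearMap.comp_apply, Submodule.mkQ_apply, Submodule.Quotient.eq, Submodule.mem_comap,
        Submodule.subtype_apply, mem_badChains_sup_range_iff h0]
      refine ⟨b, hb, ?_⟩
      rw [Submodule.coe_sub, map_sub, hfa]
      exact hab

end ChainFun

section Reach

variable {U : Type*} [DecidableEq U]

/-- The nodes `u` and `v` are joined by a chain of edges of `S` inside the node set `M`. -/
def Reach (S : Finset (Sym2 U)) (M : Finset U) : U → U → Prop :=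
  Relation.ReflTransGen fun u v => s(u, v) ∈ S ∧ u ∈ M ∧ v ∈ M

namespace Reach

variable {S S' : Finset (Sym2 U)} {M M' : Finset U} {u v w x a p q : U}

theorem edge (h : s(u, v) ∈ S) (hu : u ∈ M) (hv : v ∈ M) : Reach S M u v :=
  .single ⟨h, hu, hv⟩

theorem of_forall (h : Reach S M u v)
    (hS : ∀ x ∈ M, ∀ y ∈ M, s(x, y) ∈ S → s(x, y) ∈ S') : Reach S' M u v :=
  Relation.ReflTransGen.mono (fun x y h => ⟨hS x h.2.1 y h.2.2 h.1, h.2⟩) u v h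

theorem mono (h : Reach S M u v) (hS : S ⊆ S') (hM : M ⊆ M') : Reach S' M' u v :=
  Relation.ReflTransGen.mono (fun _ _ h => ⟨hS h.1, hM h.2.1, hM h.2.2⟩) u v h

theorem symm (h : Reach S M u v) : Reach S M v u := by
  induction h with
  | refl => exact .refl
  | tail _ hstep ih =>
    exact .head ⟨by rw [Sym2.eq_swap]; exact hstep.1, hstep.2.2, hstep.2.1⟩ ih

theorem trans (h : Reach S M u v) (h' : Reach S M v w) : Reach S M u w :=
  Relation.ReflTransGen.trans h h'

theorem right_mem (h : Reach S M u v) (huv : u ≠ v) : v ∈ M := by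
  rcases Relation.ReflTransGen.cases_tail h with h | ⟨_, _, h⟩
  · exact absurd h.symm huv
  · exact h.2.2

theorem not_erase (huv : u ≠ v) : ¬ Reach S (M.erase v) u v :=
  fun h => Finset.notMem_erase v M (h.right_mem huv)

/-- A chain starting at `u` either avoids `a` or passes through a neighbour of `a` before
reaching `a`. -/
theorem erase_or_neighbor (h : Reach S M u v) (hu : u ≠ a) :
    Reach S (M.erase a) u v ∨
      ∃ p ∈ M, p ≠ a ∧ a ∈ M ∧ s(p, a) ∈ S ∧ Reach S (M.erase a) u p := by
  induction h with
  | refl => exact .inl .refl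
  | @tail v v' h hstep ih =>
    rcases ih with ih | ih
    · by_cases hva : v = a
      · subst hva
        exact absurd ih (not_erase hu)
      by_cases hv' : v' = a
      · subst hv'
        exact .inr ⟨v, hstep.2.1, hva, hstep.2.2, hstep.1, ih⟩
      · exact .inl (ih.trans (edge hstep.1 (Finset.mem_erase.2 ⟨hva, hstep.2.1⟩)
          (Finset.mem_erase.2 ⟨hv', hstep.2.2⟩)))
    · exact .inr ih

theorem exists_neighbor (h : Reach S M u a) (hu : u ≠ a) :
    ∃ p ∈ M, p ≠ a ∧ a ∈ M ∧ s(p, a) ∈ S ∧ Reach S (M.erase a) u p :=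
  (h.erase_or_neighbor hu).resolve_left (not_erase hu)

theorem erase_of_not_reach (h : Reach S M u v) (hw : ¬ Reach S M u w) :
    Reach S (M.erase w) u v := by
  rcases h.erase_or_neighbor (a := w) (by rintro rfl; exact hw .refl) with h | ⟨p, hp, -, hw', he, h⟩
  · exact h
  · exact absurd ((h.mono subset_rfl (Finset.erase_subset _ _)).trans (edge he hp hw')) hw

/-- A chain from `u` to `x` avoids `w`, or else `w` is reached before `x`. -/
theorem erase_or_erase (h : Reach S M u x) (hux : u ≠ x) (huw : u ≠ w) (hwx : w ≠ x) :
    Reach S (M.erase w) u x ∨ Reach S (M.erase x) u w := by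
  rcases h.erase_or_neighbor (a := w) huw with h | ⟨p, hp, hpw, hw, he, h0⟩
  · exact .inl h
  · by_cases hx : Reach S (M.erase w) u x
    · exact .inl hx
    · have h1 := h0.erase_of_not_reach hx
      have hpx : p ≠ x := by
        rintro rfl
        exact hx h0
      refine .inr ((h1.mono subset_rfl ?_).trans (edge he ?_ ?_))
      · exact Finset.erase_subset_erase _ (Finset.erase_subset _ _)
      · exact Finset.mem_erase.2 ⟨hpx, hp⟩
      · exact Finset.mem_erase.2 ⟨hwx, hw⟩

theorem erase_edge (h : Reach S M u v) (hpq : Reach (S.erase s(p, q)) M p q) :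
    Reach (S.erase s(p, q)) M u v := by
  induction h with
  | refl => exact .refl
  | @tail v v' h hstep ih =>
    refine ih.trans ?_
    by_cases he : s(v, v') = s(p, q)
    · rcases Sym2.eq_iff.1 he with ⟨rfl, rfl⟩ | ⟨rfl, rfl⟩
      · exact hpq
      · exact hpq.symm
    · exact edge (Finset.mem_erase.2 ⟨he, hstep.1⟩) hstep.2.1 hstep.2.2

theorem erase_edge_or (h : Reach S M u q) :
    Reach (S.erase s(p, q)) M u p ∨ Reach (S.erase s(p, q)) M u q := by
  by_contra! hcon
  have key : ∀ v, Reach S M u v → Reach (S.erase s(p, q)) M u v := by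
    intro v h
    induction h with
    | refl => exact .refl
    | @tail v v' h hstep ih =>
      by_cases he : s(v, v') = s(p, q)
      · rcases Sym2.eq_iff.1 he with ⟨rfl, rfl⟩ | ⟨rfl, rfl⟩
        · exact absurd ih hcon.1
        · exact absurd ih hcon.2
      · exact ih.trans (edge (Finset.mem_erase.2 ⟨he, hstep.1⟩) hstep.2.1 hstep.2.2)
  exact hcon.2 (key q h)

theorem erase_edge_of_notMem (h : Reach S M u v) (hp : p ∉ M) (q : U) :
    Reach (S.erase s(p, q)) M u v := by
  refine h.of_forall fun x hx y hy he => Finset.mem_erase.2 ⟨fun h => ?_, he⟩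
  rcases Sym2.eq_iff.1 h with ⟨rfl, -⟩ | ⟨-, rfl⟩
  · exact hp hx
  · exact hp hy

theorem of_insert_edge_of_notMem (h : Reach (insert s(p, q) S) M u v) (hq : q ∉ M) :
    Reach S M u v := by
  refine h.of_forall fun x hx y hy he => (Finset.mem_insert.1 he).resolve_left fun h => ?_
  rcases Sym2.eq_iff.1 h with ⟨-, rfl⟩ | ⟨rfl, -⟩
  · exact hq hy
  · exact hq hx

theorem erase_node_of_neighbors (h : Reach S M u v) (hu : u ≠ a) (hv : v ≠ a)
    (ha : ∀ p ∈ M, ∀ q ∈ M, p ≠ a → q ≠ a → s(p, a) ∈ S → s(q, a) ∈ S →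
      Reach S (M.erase a) p q) : Reach S (M.erase a) u v := by
  rcases h.erase_or_neighbor hu with h1 | ⟨p, hp, hpa, -, hpe, h1⟩
  · exact h1
  rcases h.symm.erase_or_neighbor hv with h2 | ⟨q, hq, hqa, -, hqe, h2⟩
  · exact h2.symm
  exact (h1.trans (ha p hp q hq hpa hqa hpe hqe)).trans h2.symm

end Reach

/-- The graph with edge set `S` is 2-connected on the node set `N`. -/
def TwoConn (S : Finset (Sym2 U)) (N : Finset U) : Prop :=
  (∀ u ∈ N, ∀ v ∈ N, Reach S N u v) ∧
    ∀ x ∈ N, ∀ u ∈ N.erase x, ∀ v ∈ N.erase x, Reach S (N.erase x) u v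

namespace TwoConn

variable {S S' : Finset (Sym2 U)} {N : Finset U} {p q : U}

theorem of_forall (h : TwoConn S N)
    (hS : ∀ x ∈ N, ∀ y ∈ N, s(x, y) ∈ S → s(x, y) ∈ S') : TwoConn S' N :=
  ⟨fun u hu v hv => (h.1 u hu v hv).of_forall hS, fun x hx u hu v hv =>
    (h.2 x hx u hu v hv).of_forall fun y hy z hz =>
      hS y (Finset.mem_of_mem_erase hy) z (Finset.mem_of_mem_erase hz)⟩

theorem mono (h : TwoConn S N) (hS : S ⊆ S') : TwoConn S' N :=
  h.of_forall fun _ _ _ _ he => hS he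

theorem reach_erase_edge (h : TwoConn S N) (hN : 3 ≤ N.card) (hp : p ∈ N) (hq : q ∈ N)
    (hpq : p ≠ q) {u v : U} (hu : u ∈ N) (hv : v ∈ N) : Reach (S.erase s(p, q)) N u v := by
  refine (h.1 u hu v hv).erase_edge ?_
  obtain ⟨c, hc, hcp⟩ : ∃ c ∈ N, c ∉ ({p, q} : Finset U) := by
    by_contra! hcon
    have := Finset.card_le_card (s := N) (t := {p, q}) hcon
    have := Finset.card_le_two (a := p) (b := q)
    omega
  simp only [Finset.mem_insert, Finset.mem_singleton, not_or] at hcp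
  have h1 : Reach S (N.erase q) p c := h.2 q hq p (by simp [*]) c (by simp [*])
  have h2 : Reach S (N.erase p) c q := h.2 p hp c (by simp [*]) q (by simp [*, Ne.symm hpq])
  have h1' := h1.erase_edge_of_notMem (Finset.notMem_erase q N) p
  have h2' := h2.erase_edge_of_notMem (Finset.notMem_erase p N) q
  rw [Sym2.eq_swap] at h1'
  exact (h1'.mono subset_rfl (Finset.erase_subset _ _)).trans
    (h2'.mono subset_rfl (Finset.erase_subset _ _))

theorem erase_edge (h : TwoConn S N) (hN : 3 ≤ N.card) (hp : p ∈ N) (hq : q ∈ N)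
    (hpq : p ≠ q) (hx : ∀ x ∈ N, x ≠ p → x ≠ q → Reach (S.erase s(p, q)) (N.erase x) p q) :
    TwoConn (S.erase s(p, q)) N := by
  refine ⟨fun u hu v hv => h.reach_erase_edge hN hp hq hpq hu hv, fun x hxN u hu v hv => ?_⟩
  have h1 := h.2 x hxN u hu v hv
  by_cases hxp : x = p
  · subst hxp
    exact h1.erase_edge_of_notMem (Finset.notMem_erase _ _) q
  by_cases hxq : x = q
  · subst hxq
    rw [Sym2.eq_swap]
    exact h1.erase_edge_of_notMem (Finset.notMem_erase _ _) p
  exact h1.erase_edge (hx x hxN hxp hxq)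

end TwoConn

/-- The node `x` separates `a` from `b` once the edge `ab` has been deleted. -/
def IsCut (N : Finset U) (a b : U) (S : Finset (Sym2 U)) (x : U) : Prop :=
  x ∈ N ∧ x ≠ a ∧ x ≠ b ∧ ¬ Reach (S.erase s(a, b)) (N.erase x) a b

/-- The separating node closest to `b`. -/
def IsLastCut (N : Finset U) (a b : U) (S : Finset (Sym2 U)) (w : U) : Prop :=
  IsCut N a b S w ∧ ∀ x, IsCut N a b S x → x ≠ w → ¬ Reach (S.erase s(a, b)) (N.erase w) b x

variable {N : Finset U} {a b w x y : U} {S S' : Finset (Sym2 U)}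

theorem IsCut.anti (h : IsCut N a b S' x) (hS : S ⊆ S') : IsCut N a b S x :=
  ⟨h.1, h.2.1, h.2.2.1, fun hr =>
    h.2.2.2 (hr.mono (Finset.erase_subset_erase _ hS) subset_rfl)⟩

theorem TwoConn.erase_edge_of_not_isCut (h : TwoConn S N) (hN : 3 ≤ N.card) (ha : a ∈ N)
    (hb : b ∈ N) (hab : a ≠ b) (hcut : ∀ x, ¬ IsCut N a b S x) :
    TwoConn (S.erase s(a, b)) N := by
  refine h.erase_edge hN ha hb hab fun x hx hxa hxb => ?_
  by_contra hr
  exact hcut x ⟨hx, hxa, hxb, hr⟩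

theorem IsCut.mem_edge (hx : IsCut N a b S x) (h : TwoConn S N) (ha : a ∈ N) (hb : b ∈ N) :
    s(a, b) ∈ S := by
  by_contra hab
  refine hx.2.2.2 ?_
  rw [Finset.erase_eq_of_notMem hab]
  exact h.2 x hx.1 a (by simp [ha, hx.2.1.symm]) b (by simp [hb, hx.2.2.1.symm])

theorem IsCut.not_reach_and_reach (hw : IsCut N a b S w) (hx : IsCut N a b S x) (hwx : w ≠ x)
    (h : TwoConn S N) (hN : 3 ≤ N.card) (ha : a ∈ N) (hb : b ∈ N) (hab : a ≠ b)
    (h1 : Reach (S.erase s(a, b)) (N.erase w) b x)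
    (h2 : Reach (S.erase s(a, b)) (N.erase x) b w) : False := by
  rcases (h.reach_erase_edge hN ha hb hab ha hx.1).erase_or_erase hx.2.1.symm hw.2.1.symm hwx
    with h3 | h3
  · exact hw.2.2.2 (h3.trans h1.symm)
  · exact hx.2.2.2 (h3.trans h2.symm)

theorem IsCut.reach_or_reach (hw : IsCut N a b S w) (hx : IsCut N a b S x) (hwx : w ≠ x)
    (h : TwoConn S N) (hN : 3 ≤ N.card) (ha : a ∈ N) (hb : b ∈ N) (hab : a ≠ b) :
    Reach (S.erase s(a, b)) (N.erase w) b x ∨ Reach (S.erase s(a, b)) (N.erase x) b w :=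
  (h.reach_erase_edge hN ha hb hab hb hx.1).erase_or_erase hx.2.2.1.symm hw.2.2.1.symm hwx

theorem IsLastCut.unique (hw : IsLastCut N a b S w) (hx : IsLastCut N a b S x)
    (h : TwoConn S N) (hN : 3 ≤ N.card) (ha : a ∈ N) (hb : b ∈ N) (hab : a ≠ b) : w = x := by
  by_contra hwx
  rcases hw.1.reach_or_reach hx.1 hwx h hN ha hb hab with h1 | h1
  · exact hw.2 x hx.1 (Ne.symm hwx) h1
  · exact hx.2 w hw.1 hwx h1

open Classical in
/-- The nodes on the side of `b` once the edge `ab` and the node `w` have been deleted. -/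
def farSide (N : Finset U) (a b : U) (S : Finset (Sym2 U)) (w : U) : Finset U :=
  N.filter fun y => Reach (S.erase s(a, b)) (N.erase w) b y

theorem mem_farSide : y ∈ farSide N a b S w ↔
    y ∈ N ∧ Reach (S.erase s(a, b)) (N.erase w) b y := by
  simp [farSide]

theorem farSide_subset_of_not_reach (h : ¬ Reach (S.erase s(a, b)) (N.erase w) b x) :
    farSide N a b S w ⊆ farSide N a b S x := by
  intro y hy
  rw [mem_farSide] at hy ⊢
  exact ⟨hy.1, (hy.2.erase_of_not_reach h).mono subset_rfl
    (Finset.erase_subset_erase _ (Finset.erase_subset _ _))⟩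

theorem farSide_mono (hS : S ⊆ S') : farSide N a b S w ⊆ farSide N a b S' w := by
  intro y hy
  rw [mem_farSide] at hy ⊢
  exact ⟨hy.1, hy.2.mono (Finset.erase_subset_erase _ hS) subset_rfl⟩

theorem exists_isLastCut (h : TwoConn S N) (hN : 3 ≤ N.card) (ha : a ∈ N) (hb : b ∈ N)
    (hab : a ≠ b) (hcut : ∃ x, IsCut N a b S x) : ∃ w, IsLastCut N a b S w := by
  obtain ⟨w, hw, hmin⟩ := Set.exists_min_image {x | IsCut N a b S x}
    (fun x => (farSide N a b S x).card) (N.finite_toSet.subset fun x hx => hx.1) hcut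
  refine ⟨w, hw, fun x hx hxw hr => ?_⟩
  have h1 : ¬ Reach (S.erase s(a, b)) (N.erase x) b w := fun h2 =>
    hw.not_reach_and_reach hx hxw.symm h hN ha hb hab hr h2
  have h2 : farSide N a b S x ⊂ farSide N a b S w := by
    refine ⟨farSide_subset_of_not_reach h1, fun hsub => ?_⟩
    have := hsub (mem_farSide.2 ⟨hx.1, hr⟩)
    exact Reach.not_erase hx.2.2.1.symm (mem_farSide.1 this).2
  exact absurd (hmin x hx) (not_le.2 (Finset.card_lt_card h2))

theorem IsLastCut.card_farSide_le {w' : U} (hw : IsLastCut N a b S w)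
    (hw' : IsLastCut N a b S' w') (hS : S ⊆ S') (h : TwoConn S N) (hN : 3 ≤ N.card) (ha : a ∈ N)
    (hb : b ∈ N) (hab : a ≠ b) :
    (farSide N a b S w).card ≤ (farSide N a b S' w').card ∧
      ((farSide N a b S w).card = (farSide N a b S' w').card → w = w') := by
  by_cases hww : w = w'
  · subst hww
    exact ⟨Finset.card_le_card (farSide_mono hS), fun _ => rfl⟩
  have hcut := hw'.1.anti hS
  have h1 := hw.2 w' hcut (Ne.symm hww)
  have h2 := (hw.1.reach_or_reach hcut hww h hN ha hb hab).resolve_left h1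
  have h3 : farSide N a b S w ⊂ farSide N a b S' w' := by
    refine ⟨(farSide_subset_of_not_reach h1).trans (farSide_mono hS), fun hsub => ?_⟩
    have := hsub (farSide_mono hS (mem_farSide.2 ⟨hw.1.1, h2⟩))
    exact Reach.not_erase hw.1.2.2.1.symm (mem_farSide.1 this).2
  have := Finset.card_lt_card h3
  exact ⟨this.le, fun h => absurd h this.ne⟩

/-- If the side of `a` contains another node `y`, then `a` and `w` are joined through that side
without using the edge `aw`. -/
theorem IsCut.reach_erase_edge (hw : IsCut N a b S w) (h : TwoConn S N) (ha : a ∈ N)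
    (hb : b ∈ N) (hy : y ∈ N) (hya : y ≠ a) (hyw : y ≠ w)
    (hyb : ¬ Reach (S.erase s(a, b)) (N.erase w) b y)
    (hx : Reach (S.erase s(a, b)) (N.erase w) b x) :
    Reach ((S.erase s(a, b)).erase s(a, w)) (N.erase x) a w := by
  obtain ⟨hwN, hwa, hwb, hcut⟩ := hw
  have h1 : Reach (S.erase s(a, b)) (N.erase w) a y := by
    have : Reach S (N.erase w) y b := h.2 w hwN y (by simp [*]) b (by simp [hb, hwb.symm])
    rcases this.erase_edge_or (p := a) with h2 | h2
    · exact h2.symm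
    · exact absurd h2.symm hyb
  have h2 : ¬ Reach (S.erase s(a, b)) (N.erase w) a x := fun h2 => hcut (h2.trans hx.symm)
  have h3 := ((h1.erase_of_not_reach h2).erase_edge_of_notMem (p := w)
    (by simp) a).mono subset_rfl (Finset.erase_subset_erase x (Finset.erase_subset w N))
  rw [Sym2.eq_swap (a := w) (b := a)] at h3
  refine h3.trans ?_
  have h4 : Reach S (N.erase a) y w := h.2 a ha y (by simp [*]) w (by simp [*])
  have h5 := (h4.erase_edge_of_notMem (Finset.notMem_erase a N) b).erase_edge_of_notMem
    (Finset.notMem_erase a N) w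
  have hyx : y ≠ x := by
    rintro rfl
    exact hyb hx
  have hxw : x ≠ w := by
    rintro rfl
    exact Reach.not_erase hwb.symm hx
  rcases h5.erase_or_erase hyw hyx hxw with h6 | h6
  · exact h6.mono subset_rfl (Finset.erase_subset_erase x (Finset.erase_subset a N))
  · refine absurd (h1.trans (h6.mono (Finset.erase_subset _ _) ?_)) h2
    exact Finset.erase_subset_erase w (Finset.erase_subset a N)

theorem IsCut.twoConn_erase (hw : IsCut N a b S w) (h : TwoConn S N) (hN : 3 ≤ N.card)
    (ha : a ∈ N) (hb : b ∈ N) (hab : a ≠ b) (hy : y ∈ N) (hya : y ≠ a) (hyw : y ≠ w)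
    (hyb : ¬ Reach (S.erase s(a, b)) (N.erase w) b y) : TwoConn (S.erase s(a, w)) N := by
  obtain ⟨hwN, hwa, hwb, hcut⟩ := id hw
  refine h.erase_edge hN ha hwN hwa.symm fun x hx hxa hxw => ?_
  by_cases hxb : Reach (S.erase s(a, b)) (N.erase w) b x
  · exact (hw.reach_erase_edge h ha hb hy hya hyw hyb hxb).mono
      (Finset.erase_subset_erase _ (Finset.erase_subset _ _)) subset_rfl
  have hbx : b ≠ x := by
    rintro rfl
    exact hxb .refl
  have h1 : Reach (S.erase s(a, w)) (N.erase a) b w :=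
    (h.2 a ha b (by simp [hb, hab.symm]) w (by simp [*])).erase_edge_of_notMem
      (Finset.notMem_erase a N) w
  have h2 : Reach (S.erase s(a, w)) (N.erase x) a b := by
    refine Reach.edge (Finset.mem_erase.2 ⟨fun he => ?_, hw.mem_edge h ha hb⟩) ?_ ?_
    · rcases Sym2.eq_iff.1 he with ⟨-, h⟩ | ⟨h, -⟩
      · exact hwb h.symm
      · exact hwa h.symm
    · simp [ha, hxa.symm]
    · simp [hb, hbx]
  refine h2.trans ?_
  rcases h1.erase_or_erase hwb.symm hbx hxw with h3 | h3
  · exact h3.mono subset_rfl (Finset.erase_subset_erase x (Finset.erase_subset a N))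
  · refine absurd ?_ hxb
    exact ((h3.mono (Finset.erase_subset _ _) subset_rfl).erase_edge_of_notMem (p := a)
      (by simp) b).mono subset_rfl (Finset.erase_subset_erase w (Finset.erase_subset a N))

theorem reach_erase_edge_iff {u v : U} : Reach ((S.erase s(a, w)).erase s(a, b)) (N.erase w) u v ↔
    Reach (S.erase s(a, b)) (N.erase w) u v := by
  rw [Finset.erase_right_comm]
  refine ⟨fun h => h.mono (Finset.erase_subset _ _) subset_rfl, fun h => ?_⟩
  rw [Sym2.eq_swap (a := a) (b := w)]
  exact h.erase_edge_of_notMem (Finset.notMem_erase w N) a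

theorem reach_insert_edge_iff {u v : U} (hwb : w ≠ b) (hwa : w ≠ a) :
    Reach ((insert s(a, w) S).erase s(a, b)) (N.erase w) u v ↔
      Reach (S.erase s(a, b)) (N.erase w) u v := by
  have hne : s(a, w) ≠ s(a, b) := fun he => by
    rcases Sym2.eq_iff.1 he with ⟨-, h⟩ | ⟨-, h⟩
    · exact hwb h
    · exact hwa h
  rw [Finset.erase_insert_of_ne hne]
  exact ⟨fun h => h.of_insert_edge_of_notMem (Finset.notMem_erase w N),
    fun h => h.mono (Finset.subset_insert _ _) subset_rfl⟩

theorem IsLastCut.insert_edge (hw : IsLastCut N a b S w) :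
    IsLastCut N a b (insert s(a, w) S) w := by
  obtain ⟨hwN, hwa, hwb, hcut⟩ := hw.1
  refine ⟨⟨hwN, hwa, hwb, by rwa [reach_insert_edge_iff hwb hwa]⟩, fun x hx hxw => ?_⟩
  rw [reach_insert_edge_iff hwb hwa]
  exact hw.2 x (hx.anti (Finset.subset_insert _ _)) hxw

theorem IsLastCut.erase_edge (hw : IsLastCut N a b S w) (h : TwoConn S N)
    (ha : a ∈ N) (hb : b ∈ N) (hy : y ∈ N) (hya : y ≠ a) (hyw : y ≠ w)
    (hyb : ¬ Reach (S.erase s(a, b)) (N.erase w) b y) :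
    IsLastCut N a b (S.erase s(a, w)) w := by
  obtain ⟨hwN, hwa, hwb, hcut⟩ := id hw.1
  refine ⟨⟨hwN, hwa, hwb, by rwa [reach_erase_edge_iff]⟩, fun x hx hxw hr => ?_⟩
  rw [reach_erase_edge_iff] at hr
  refine hw.2 x ⟨hx.1, hx.2.1, hx.2.2.1, fun hab => hx.2.2.2 ?_⟩ hxw hr
  rw [Finset.erase_right_comm]
  exact hab.erase_edge (hw.1.reach_erase_edge h ha hb hy hya hyw hyb hr)

theorem farSide_erase_edge : farSide N a b (S.erase s(a, w)) w = farSide N a b S w := by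
  ext y
  rw [mem_farSide, mem_farSide, reach_erase_edge_iff]

theorem farSide_insert_edge (hwb : w ≠ b) (hwa : w ≠ a) :
    farSide N a b (insert s(a, w) S) w = farSide N a b S w := by
  ext y
  rw [mem_farSide, mem_farSide, reach_insert_edge_iff hwb hwa]

/-- If the side of `a` is `{a}`, then `a` has exactly the neighbours `b` and `w`, and deleting `a`
leaves a 2-connected graph. -/
theorem IsLastCut.of_reach (hw : IsLastCut N a b S w) (h : TwoConn S N)
    (ha : a ∈ N) (hb : b ∈ N) (hab : a ≠ b)
    (hall : ∀ y ∈ N, y ≠ a → y ≠ w → Reach (S.erase s(a, b)) (N.erase w) b y) :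
    (∀ v ∈ N, v ≠ a → s(a, v) ∈ S → v = b ∨ v = w) ∧ s(a, b) ∈ S ∧ s(a, w) ∈ S ∧
      TwoConn S (N.erase a) := by
  obtain ⟨hwN, hwa, hwb, hcut⟩ := id hw.1
  have hnb : ∀ v ∈ N, v ≠ a → s(a, v) ∈ S → v = b ∨ v = w := by
    intro v hv hva he
    by_contra! hcon
    refine hcut (Reach.trans (v := v) (Reach.edge (Finset.mem_erase.2 ⟨fun h => ?_, he⟩) ?_ ?_)
      (hall v hv hva hcon.2).symm)
    · rcases Sym2.eq_iff.1 h with ⟨-, h⟩ | ⟨-, h⟩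
      · exact hcon.1 h
      · exact hva h
    · simp [ha, hwa.symm]
    · simp [hv, hcon.2]
  have hswap : ∀ v, s(v, a) ∈ S → s(a, v) ∈ S := fun v hv => by rwa [Sym2.eq_swap]
  refine ⟨hnb, hw.1.mem_edge h ha hb, ?_, fun u hu v hv => h.2 a ha u hu v hv, ?_⟩
  · have h1 : Reach S (N.erase b) w a := h.2 b hb w (by simp [*]) a (by simp [*])
    obtain ⟨p, hp, hpa, -, hpe, -⟩ := h1.exists_neighbor hwa
    rw [Finset.mem_erase] at hp
    rcases hnb p hp.2 hpa (hswap p hpe) with rfl | rfl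
    · exact absurd rfl hp.1
    · exact hswap _ hpe
  · intro x hx
    simp only [Finset.mem_erase] at hx
    obtain ⟨hxa, hxN⟩ := hx
    rw [Finset.erase_right_comm]
    by_cases hxw : x = w
    · subst hxw
      have key : ∀ u ∈ (N.erase x).erase a, Reach S ((N.erase x).erase a) b u := by
        intro u hu
        simp only [Finset.mem_erase] at hu
        exact ((hall u hu.2.2 hu.1 hu.2.1).erase_of_not_reach fun h => hcut h.symm).mono
          (Finset.erase_subset _ _) subset_rfl
      exact fun u hu v hv => (key u hu).symm.trans (key v hv)
    · intro u hu v hv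
      simp only [Finset.mem_erase] at hu hv
      refine (h.2 x hxN u (by simp [hu]) v (by simp [hv])).erase_node_of_neighbors hu.1 hv.1 ?_
      have hwb' : b ≠ x → Reach S ((N.erase x).erase a) b w := by
        intro hbx
        have hr : Reach (S.erase s(a, b)) (N.erase x) a b := by
          by_contra hr
          exact hw.2 x ⟨hxN, hxa, hbx.symm, hr⟩ hxw (hall x hxN hxa hxw)
        obtain ⟨p, hp, hpa, -, hpe, hr⟩ := hr.symm.exists_neighbor hab.symm
        rw [Finset.mem_erase] at hp hpe
        rcases hnb p hp.2 hpa (hswap p hpe.2) with rfl | rfl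
        · exact absurd Sym2.eq_swap hpe.1
        · exact hr.mono (Finset.erase_subset _ _) subset_rfl
      intro p hp q hq hpa hqa hpe hqe
      rw [Finset.mem_erase] at hp hq
      rcases hnb p hp.2 hpa (hswap p hpe) with rfl | rfl <;>
        rcases hnb q hq.2 hqa (hswap q hqe) with rfl | rfl
      · exact .refl
      · exact hwb' hp.1
      · exact (hwb' hq.1).symm
      · exact .refl

theorem TwoConn.of_erase_node (h : TwoConn S (N.erase a)) (ha : a ∈ N) (hb : b ∈ N)
    (hab : a ≠ b) (hwN : w ∈ N) (hwa : w ≠ a) (hwb : w ≠ b) (hSb : s(a, b) ∈ S)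
    (hSw : s(a, w) ∈ S) : TwoConn S N := by
  have hb' : b ∈ N.erase a := by simp [hb, hab.symm]
  constructor
  · have key : ∀ u ∈ N, Reach S N u b := by
      intro u hu
      by_cases hua : u = a
      · subst hua
        exact .edge hSb hu hb
      · exact (h.1 u (by simp [hu, hua]) b hb').mono subset_rfl (Finset.erase_subset _ _)
    exact fun u hu v hv => (key u hu).trans (key v hv).symm
  · intro x hx
    by_cases hxa : x = a
    · subst hxa
      exact h.1
    obtain ⟨c, hc, hcx, hca, hSc⟩ : ∃ c ∈ N, c ≠ x ∧ c ≠ a ∧ s(a, c) ∈ S := by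
      by_cases hxb : x = b
      · exact ⟨w, hwN, by rwa [hxb], hwa, hSw⟩
      · exact ⟨b, hb, Ne.symm hxb, hab.symm, hSb⟩
    have key : ∀ u ∈ N.erase x, Reach S (N.erase x) u c := by
      intro u hu
      by_cases hua : u = a
      · subst hua
        exact .edge hSc hu (by simp [*])
      · refine (h.2 x (by simp [*]) u ?_ c (by simp [*])).mono subset_rfl
          (Finset.erase_subset_erase x (Finset.erase_subset a N))
        simp only [Finset.mem_erase] at hu ⊢
        exact ⟨hu.1, hua, hu.2⟩
    exact fun u hu v hv => (key u hu).trans (key v hv).symm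

theorem isLastCut_of_erase_node (h : TwoConn S (N.erase a)) (ha : a ∈ N) (hb : b ∈ N)
    (hab : a ≠ b) (hwN : w ∈ N) (hwa : w ≠ a) (hwb : w ≠ b)
    (hSw : s(a, w) ∈ S) (hnb : ∀ v ∈ N, v ≠ a → s(a, v) ∈ S → v = b ∨ v = w) :
    IsLastCut N a b S w ∧
      ∀ y ∈ N, y ≠ a → y ≠ w → Reach (S.erase s(a, b)) (N.erase w) b y := by
  have hne : s(a, w) ≠ s(a, b) := fun he => by
    rcases Sym2.eq_iff.1 he with ⟨-, h⟩ | ⟨-, h⟩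
    · exact hwb h
    · exact hwa h
  refine ⟨⟨⟨hwN, hwa, hwb, fun hr => ?_⟩, fun x hx hxw _ => hx.2.2.2 ?_⟩, fun y hy hya hyw => ?_⟩
  · obtain ⟨p, hp, hpa, -, hpe, -⟩ := hr.symm.exists_neighbor hab.symm
    rw [Finset.mem_erase] at hp hpe
    rcases hnb p hp.2 hpa (by rw [Sym2.eq_swap]; exact hpe.2) with rfl | rfl
    · exact hpe.1 Sym2.eq_swap
    · exact hp.1 rfl
  · have h1 := (h.2 x (by simp [hx.1, hx.2.1]) w (by simp [*, hxw.symm]) b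
      (by simp [hb, hab.symm, hx.2.2.1.symm])).erase_edge_of_notMem (p := a) (by simp) b
    refine Reach.trans (v := w) (Reach.edge (Finset.mem_erase.2 ⟨hne, hSw⟩) ?_ ?_)
      (h1.mono subset_rfl (Finset.erase_subset_erase x (Finset.erase_subset a N)))
    · simp [ha, hx.2.1.symm]
    · simp [hwN, hxw.symm]
  · have h1 := (h.2 w (by simp [*]) b (by simp [hb, hab.symm, hwb.symm]) y
      (by simp [*])).erase_edge_of_notMem (p := a) (by simp) b
    exact h1.mono subset_rfl (Finset.erase_subset_erase w (Finset.erase_subset a N))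

end Reach

section Collections

variable {ι U : Type*} [DecidableEq U]

/-- `S` is a collection of 2-connected graphs on the node sets `N j`. -/
def IsTwoConnCollection (N : ι → Finset U) (S : Finset (Sym2 U)) : Prop :=
  (∀ e ∈ S, ∃ j, ∃ u ∈ N j, ∃ v ∈ N j, u ≠ v ∧ e = s(u, v)) ∧ ∀ j, TwoConn S (N j)

variable {N : ι → Finset U} {S : Finset (Sym2 U)} {j : ι} {u v : U}

theorem IsTwoConnCollection.insert (h : IsTwoConnCollection N S) (hu : u ∈ N j) (hv : v ∈ N j)
    (huv : u ≠ v) : IsTwoConnCollection N (insert s(u, v) S) := by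
  refine ⟨fun e he => ?_, fun i => (h.2 i).mono (Finset.subset_insert _ _)⟩
  rcases Finset.mem_insert.1 he with rfl | he
  · exact ⟨j, u, hu, v, hv, huv, rfl⟩
  · exact h.1 e he

theorem sym2_ne_of_disjoint {M M' : Finset U} (h : Disjoint M M') (hu : u ∈ M) (v : U)
    {x y : U} (hx : x ∈ M') (hy : y ∈ M') : s(x, y) ≠ s(u, v) := by
  intro he
  rcases Sym2.eq_iff.1 he with ⟨rfl, -⟩ | ⟨-, rfl⟩
  · exact Finset.disjoint_left.1 h hu hx
  · exact Finset.disjoint_left.1 h hu hy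

theorem IsTwoConnCollection.erase (hN : Pairwise (Function.onFun Disjoint N))
    (h : IsTwoConnCollection N S) (hu : u ∈ N j) (hj : TwoConn (S.erase s(u, v)) (N j)) :
    IsTwoConnCollection N (S.erase s(u, v)) := by
  refine ⟨fun e he => h.1 e (Finset.mem_of_mem_erase he), fun i => ?_⟩
  by_cases hij : i = j
  · subst hij
    exact hj
  · refine (h.2 i).of_forall fun x hx y hy he => Finset.mem_erase.2 ⟨?_, he⟩
    exact sym2_ne_of_disjoint (hN (Ne.symm hij)) hu v hx hy

variable [DecidableEq ι]

/-- The collections in which `a` has exactly the two neighbours `b` and `w` and whose deletion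
of `a` is again a collection of 2-connected graphs. -/
theorem image_isTwoConnCollection_update {a b w : U} (hN : Pairwise (Function.onFun Disjoint N))
    (ha : a ∈ N j) (hb : b ∈ N j) (hab : a ≠ b) (hw : w ∈ N j) (hwa : w ≠ a) (hwb : w ≠ b) :
    (({s(a, b), s(a, w)} : Finset (Sym2 U)) ∪ ·) ''
        {S | IsTwoConnCollection (Function.update N j ((N j).erase a)) S} =
      {S | IsTwoConnCollection N S ∧ IsLastCut (N j) a b S w ∧
        ∀ y ∈ N j, y ≠ a → y ≠ w → Reach (S.erase s(a, b)) ((N j).erase w) b y} := by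
  ext S
  constructor
  · rintro ⟨S, ⟨hsupp, hconn⟩, rfl⟩
    have hj : TwoConn S ((N j).erase a) := by simpa using hconn j
    have hi : ∀ i ≠ j, TwoConn S (N i) := fun i hij => by
      simpa [Function.update_of_ne hij] using hconn i
    have hsub : S ⊆ {s(a, b), s(a, w)} ∪ S := Finset.subset_union_right
    have hSb : s(a, b) ∈ ({s(a, b), s(a, w)} : Finset (Sym2 U)) ∪ S := by simp
    have hSw : s(a, w) ∈ ({s(a, b), s(a, w)} : Finset (Sym2 U)) ∪ S := by simp
    have hsupp' : ∀ e ∈ S, ∃ i, ∃ u ∈ N i, ∃ v ∈ N i, u ≠ v ∧ e = s(u, v) ∧ u ≠ a ∧ v ≠ a := by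
      intro e he
      obtain ⟨i, u, hu, v, hv, huv, rfl⟩ := hsupp e he
      by_cases hij : i = j
      · subst hij
        simp only [Function.update_self, Finset.mem_erase] at hu hv
        exact ⟨i, u, hu.2, v, hv.2, huv, rfl, hu.1, hv.1⟩
      · rw [Function.update_of_ne hij] at hu hv
        refine ⟨i, u, hu, v, hv, huv, rfl, ?_, ?_⟩ <;> rintro rfl
        · exact Finset.disjoint_left.1 (hN hij) hu ha
        · exact Finset.disjoint_left.1 (hN hij) hv ha
    refine ⟨⟨fun e he => ?_, fun i => ?_⟩, isLastCut_of_erase_node (hj.mono hsub) ha hb hab hw hwa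
      hwb hSw fun v _ _ he => ?_⟩
    · simp only [Finset.mem_union, Finset.mem_insert, Finset.mem_singleton] at he
      rcases he with (rfl | rfl) | he
      · exact ⟨j, a, ha, b, hb, hab, rfl⟩
      · exact ⟨j, a, ha, w, hw, hwa.symm, rfl⟩
      · obtain ⟨i, u, hu, v, hv, huv, he, -⟩ := hsupp' e he
        exact ⟨i, u, hu, v, hv, huv, he⟩
    · by_cases hij : i = j
      · subst hij
        exact (hj.mono hsub).of_erase_node ha hb hab hw hwa hwb hSb hSw
      · exact (hi i hij).mono hsub
    · simp only [Finset.mem_union, Finset.mem_insert, Finset.mem_singleton] at he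
      rcases he with (he | he) | he
      · exact .inl (Sym2.congr_right.1 he)
      · exact .inr (Sym2.congr_right.1 he)
      · obtain ⟨i, u, -, v', -, -, he, hua, hva⟩ := hsupp' _ he
        rcases Sym2.eq_iff.1 he with ⟨h, -⟩ | ⟨h, -⟩
        · exact absurd h.symm hua
        · exact absurd h.symm hva
  · rintro ⟨⟨hsupp, hconn⟩, hlast, hall⟩
    obtain ⟨hnb, hSb, hSw, hdel⟩ := hlast.of_reach (hconn j) ha hb hab hall
    refine ⟨S \ {s(a, b), s(a, w)}, ⟨fun e he => ?_, fun i => ?_⟩, ?_⟩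
    · simp only [Finset.mem_sdiff, Finset.mem_insert, Finset.mem_singleton, not_or] at he
      obtain ⟨i, u, hu, v, hv, huv, rfl⟩ := hsupp e he.1
      by_cases hij : i = j
      · subst hij
        have hua : u ≠ a := by
          rintro rfl
          rcases hnb v hv huv.symm he.1 with rfl | rfl
          · exact he.2.1 rfl
          · exact he.2.2 rfl
        have hva : v ≠ a := by
          rintro rfl
          rw [Sym2.eq_swap] at he
          rcases hnb u hu huv he.1 with rfl | rfl
          · exact he.2.1 rfl
          · exact he.2.2 rfl
        refine ⟨i, u, ?_, v, ?_, huv, rfl⟩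
        · rw [Function.update_self]
          exact Finset.mem_erase.2 ⟨hua, hu⟩
        · rw [Function.update_self]
          exact Finset.mem_erase.2 ⟨hva, hv⟩
      · refine ⟨i, u, ?_, v, ?_, huv, rfl⟩ <;> rwa [Function.update_of_ne hij]
    · by_cases hij : i = j
      · subst hij
        rw [Function.update_self]
        have hdisj : Disjoint {a} ((N i).erase a) := by simp
        refine hdel.of_forall fun x hx y hy he => ?_
        have h1 := sym2_ne_of_disjoint hdisj (Finset.mem_singleton_self a) b hx hy
        have h2 := sym2_ne_of_disjoint hdisj (Finset.mem_singleton_self a) w hx hy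
        simp [he, h1, h2]
      · rw [Function.update_of_ne hij]
        refine (hconn i).of_forall fun x hx y hy he => ?_
        have h1 := sym2_ne_of_disjoint (hN (Ne.symm hij)) ha b hx hy
        have h2 := sym2_ne_of_disjoint (hN (Ne.symm hij)) ha w hx hy
        simp [he, h1, h2]
    · refine Finset.union_sdiff_of_subset ?_
      simp [Finset.insert_subset_iff, hSb, hSw]

/-- Reduction of the family of collections of 2-connected graphs to the collections with one
node `a` fewer. -/
theorem MorseFiltration.isTwoConnCollection_of_update [Finite U] {a b : U} {k r : ℕ}
    (hN : Pairwise (Function.onFun Disjoint N)) (ha : a ∈ N j) (hb : b ∈ N j) (hab : a ≠ b)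
    (hcard : 3 ≤ (N j).card)
    (h : MorseFiltration k {S | IsTwoConnCollection (Function.update N j ((N j).erase a)) S} r) :
    MorseFiltration (2 + k) {S | IsTwoConnCollection N S} (((N j).card - 2) * r) := by
  classical
  have hex : ∀ S, ∃ w, IsTwoConnCollection N S → (∃ x, IsCut (N j) a b S x) →
      IsLastCut (N j) a b S w := by
    intro S
    by_cases hS : IsTwoConnCollection N S ∧ ∃ x, IsCut (N j) a b S x
    · obtain ⟨w, hw⟩ := exists_isLastCut (hS.1.2 j) hcard ha hb hab hS.2
      exact ⟨w, fun _ _ => hw⟩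
    · exact ⟨a, fun h1 h2 => absurd ⟨h1, h2⟩ hS⟩
  choose w hw using hex
  set F₁ : Set (Finset (Sym2 U)) :=
    {S | IsTwoConnCollection N S ∧ ∀ x, ¬ IsCut (N j) a b S x} with hF₁
  set K : U → Set (Finset (Sym2 U)) := fun w =>
    {S | IsTwoConnCollection N S ∧ IsLastCut (N j) a b S w ∧
        ∀ y ∈ N j, y ≠ a → y ≠ w → Reach (S.erase s(a, b)) ((N j).erase w) b y} with hK
  set F₂ : Set (Finset (Sym2 U)) :=
    {S | IsTwoConnCollection N S ∧ IsLastCut (N j) a b S (w S) ∧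
        ∃ y ∈ N j, y ≠ a ∧ y ≠ w S ∧
          ¬ Reach (S.erase s(a, b)) ((N j).erase (w S)) b y} with hF₂
  have hF₁m : MorseFiltration (2 + k) F₁ 0 := by
    have := MorseFiltration.union_of_toggle (MorseFiltration.empty (k := 2 + k))
      (fun _ => s(a, b)) (fun _ => 0) F₁ (by simp) ?_ ?_ (by simp)
    · simpa using this
    · rintro S ⟨hS, hcut⟩
      refine ⟨⟨hS.insert ha hb hab, fun x hx => hcut x (hx.anti (Finset.subset_insert _ _))⟩,
        rfl, rfl⟩
    · rintro S ⟨hS, hcut⟩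
      refine ⟨⟨hS.erase hN ha ((hS.2 j).erase_edge_of_not_isCut hcard ha hb hab hcut),
        fun x hx => hcut x ?_⟩, rfl, rfl⟩
      have := hx.2.2.2
      rw [Finset.erase_eq_of_notMem (Finset.notMem_erase _ _)] at this
      exact ⟨hx.1, hx.2.1, hx.2.2.1, this⟩
  have hKm : ∀ w ∈ ((N j).erase a).erase b, MorseFiltration (2 + k) (K w) r := by
    intro w hw
    simp only [Finset.mem_erase] at hw
    simp only [hK]
    rw [← image_isTwoConnCollection_update hN ha hb hab hw.2.2 hw.2.1 hw.1]
    have hpair : ({s(a, b), s(a, w)} : Finset (Sym2 U)).card = 2 := by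
      refine Finset.card_pair fun he => hw.1 ?_
      exact (Sym2.congr_right.1 he).symm
    rw [← hpair]
    refine h.image_union _ fun S hS => ?_
    rw [Finset.disjoint_left]
    have : ∀ v, s(a, v) ∉ S := by
      intro v hv
      obtain ⟨i, u, hu, v', hv', -, he⟩ := hS.1 _ hv
      have hai : a ∈ Function.update N j ((N j).erase a) i := by
        rcases Sym2.eq_iff.1 he with ⟨rfl, -⟩ | ⟨rfl, -⟩
        · exact hu
        · exact hv'
      by_cases hij : i = j
      · subst hij
        simp at hai
      · rw [Function.update_of_ne hij] at hai
        exact Finset.disjoint_left.1 (hN hij) hai ha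
    intro e he
    simp only [Finset.mem_insert, Finset.mem_singleton] at he
    rcases he with rfl | rfl
    · exact this b
    · exact this w
  have hKu := MorseFiltration.iUnion (((N j).erase a).erase b) hKm (by
    rintro w₁ - w₂ - hne T ⟨hT, hTl, hTa⟩ S ⟨hS, hSl, hSa⟩ hTS
    obtain ⟨-, -, hTw, -⟩ := hTl.of_reach (hT.2 j) ha hb hab hTa
    obtain ⟨hnb, -⟩ := hSl.of_reach (hS.2 j) ha hb hab hSa
    rcases hnb w₁ hTl.1.1 hTl.1.2.1 (hTS hTw) with h | h
    · exact hTl.1.2.2.1 h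
    · exact hne h)
  have hc : (((N j).erase a).erase b).card = (N j).card - 2 := by
    rw [Finset.card_erase_of_mem (Finset.mem_erase.2 ⟨hab.symm, hb⟩),
      Finset.card_erase_of_mem ha]
    omega
  rw [hc] at hKu
  have hmemK : ∀ S, (S ∈ ⋃ w ∈ ((N j).erase a).erase b, K w) ↔ S ∈ K (w S) := by
    intro S
    simp only [Set.mem_iUnion, Finset.mem_erase]
    constructor
    · rintro ⟨v, -, hS⟩
      have h1 := hw S hS.1 ⟨v, hS.2.1.1⟩
      rwa [h1.unique hS.2.1 (hS.1.2 j) hcard ha hb hab]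
    · intro hS
      exact ⟨w S, ⟨hS.2.1.1.2.2.1, hS.2.1.1.2.1, hS.2.1.1.1⟩, hS⟩
  have hF₁K := hF₁m.union hKu (by
    intro T hT S hS hTS
    rw [hmemK] at hS
    exact hT.2 _ (hS.2.1.1.anti hTS))
  rw [zero_add] at hF₁K
  have hwins : ∀ S ∈ F₂, insert s(a, w S) S ∈ F₂ ∧ w (insert s(a, w S) S) = w S := by
    rintro S ⟨hS, hl, y, hy, hya, hyw, hyb⟩
    have h1 := hS.insert ha hl.1.1 hl.1.2.1.symm
    have h2 := hl.insert_edge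
    have h3 : w (insert s(a, w S) S) = w S :=
      (hw _ h1 ⟨_, h2.1⟩).unique h2 (h1.2 j) hcard ha hb hab
    refine ⟨⟨h1, by rwa [h3], y, hy, hya, by rwa [h3], ?_⟩, h3⟩
    rwa [h3, reach_insert_edge_iff hl.1.2.2.1 hl.1.2.1]
  have hwers : ∀ S ∈ F₂, S.erase s(a, w S) ∈ F₂ ∧ w (S.erase s(a, w S)) = w S := by
    rintro S ⟨hS, hl, y, hy, hya, hyw, hyb⟩
    have h1 := hS.erase hN ha
      (hl.1.twoConn_erase (hS.2 j) hcard ha hb hab hy hya hyw hyb)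
    have h2 := hl.erase_edge (hS.2 j) ha hb hy hya hyw hyb
    have h3 : w (S.erase s(a, w S)) = w S :=
      (hw _ h1 ⟨_, h2.1⟩).unique h2 (h1.2 j) hcard ha hb hab
    refine ⟨⟨h1, by rwa [h3], y, hy, hya, by rwa [h3], ?_⟩, h3⟩
    rwa [h3, reach_erase_edge_iff]
  have hfinal := hF₁K.union_of_toggle (fun S => s(a, w S))
    (fun S => (farSide (N j) a b S (w S)).card) F₂ ?_ ?_ ?_ ?_
  · convert hfinal using 1
    ext S
    simp only [Set.mem_union, hmemK]
    constructor
    · intro hS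
      by_cases hcut : ∃ x, IsCut (N j) a b S x
      · have hl := hw S hS hcut
        by_cases hall : ∀ y ∈ N j, y ≠ a → y ≠ w S →
            Reach (S.erase s(a, b)) ((N j).erase (w S)) b y
        · exact .inl (.inr ⟨hS, hl, hall⟩)
        · push Not at hall
          exact .inr ⟨hS, hl, hall⟩
      · exact .inl (.inl ⟨hS, not_exists.1 hcut⟩)
    · rintro ((hS | hS) | hS) <;> exact hS.1
  · rintro T (hT | hT) S hS hTS
    · exact hT.2 _ (hS.2.1.1.anti hTS)
    · rw [hmemK] at hT
      obtain ⟨hT, hTl, hTa⟩ := hT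
      obtain ⟨hS, hSl, y, hy, hya, hyw, hyb⟩ := hS
      have hle := hTl.card_farSide_le hSl hTS (hT.2 j) hcard ha hb hab
      have hsub : farSide (N j) a b S (w S) ⊆ ((N j).erase a).erase (w S) := by
        intro x hx
        rw [mem_farSide] at hx
        simp only [Finset.mem_erase]
        refine ⟨?_, ?_, hx.1⟩
        · intro hxw
          rw [hxw] at hx
          exact Reach.not_erase hSl.1.2.2.1.symm hx.2
        · rintro rfl
          exact hSl.1.2.2.2 hx.2.symm
      have hsup : ((N j).erase a).erase (w T) ⊆ farSide (N j) a b T (w T) := by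
        intro x hx
        simp only [Finset.mem_erase] at hx
        exact mem_farSide.2 ⟨hx.2.2, hTa x hx.2.2 hx.2.1 hx.1⟩
      have hlt : farSide (N j) a b S (w S) ⊂ ((N j).erase a).erase (w S) := by
        refine ⟨hsub, fun h => hyb ?_⟩
        have : y ∈ ((N j).erase a).erase (w S) := by simp [*]
        exact (mem_farSide.1 (h this)).2
      have h1 := Finset.card_lt_card hlt
      have h2 := Finset.card_le_card hsup
      rw [Finset.card_erase_of_mem (by simp [hSl.1.1, hSl.1.2.1])] at h1
      rw [Finset.card_erase_of_mem (by simp [hTl.1.1, hTl.1.2.1])] at h2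
      omega
  · intro S hS
    obtain ⟨h1, h2⟩ := hwins S hS
    refine ⟨h1, ?_, by simp only [h2]⟩
    simp only [h2]
    rw [farSide_insert_edge hS.2.1.1.2.2.1 hS.2.1.1.2.1]
  · intro S hS
    obtain ⟨h1, h2⟩ := hwers S hS
    refine ⟨h1, ?_, by simp only [h2]⟩
    simp only [h2]
    rw [farSide_erase_edge]
  · rintro S ⟨hS, hSl, -⟩ T ⟨hT, hTl, -⟩ hST
    have := hSl.card_farSide_le hTl hST (hS.2 j) hcard ha hb hab
    exact ⟨this.1, fun h => by simp only [this.2 h]⟩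

theorem isTwoConnCollection_iff_of_card_eq_two [Fintype ι] {p q : ι → U} (hpq : ∀ j, p j ≠ q j)
    (hN : ∀ j, N j = {p j, q j}) :
    IsTwoConnCollection N S ↔ S = Finset.univ.image fun j => s(p j, q j) := by
  constructor
  · rintro ⟨hsupp, hconn⟩
    ext e
    simp only [Finset.mem_image, Finset.mem_univ, true_and]
    constructor
    · intro he
      obtain ⟨j, u, hu, v, hv, huv, rfl⟩ := hsupp e he
      refine ⟨j, ?_⟩
      simp only [hN, Finset.mem_insert, Finset.mem_singleton] at hu hv
      rcases hu with rfl | rfl <;> rcases hv with rfl | rfl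
      · exact absurd rfl huv
      · rfl
      · exact Sym2.eq_swap
      · exact absurd rfl huv
    · rintro ⟨j, rfl⟩
      obtain ⟨x, hx, hxq, -, he, -⟩ := ((hconn j).1 (p j) (by simp [hN]) (q j)
        (by simp [hN])).exists_neighbor (hpq j)
      simp only [hN, Finset.mem_insert, Finset.mem_singleton, hxq, or_false] at hx
      rwa [← hx]
  · rintro rfl
    refine ⟨fun e he => ?_, fun j => ?_⟩
    · simp only [Finset.mem_image, Finset.mem_univ, true_and] at he
      obtain ⟨j, rfl⟩ := he
      exact ⟨j, p j, by simp [hN], q j, by simp [hN], hpq j, rfl⟩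
    · have hr : Reach (Finset.univ.image fun j => s(p j, q j)) (N j) (p j) (q j) :=
        .edge (Finset.mem_image.2 ⟨j, Finset.mem_univ j, rfl⟩) (by simp [hN]) (by simp [hN])
      constructor
      · intro u hu v hv
        simp only [hN j, Finset.mem_insert, Finset.mem_singleton] at hu hv
        rcases hu with rfl | rfl <;> rcases hv with rfl | rfl
        · exact .refl
        · exact hr
        · exact hr.symm
        · exact .refl
      · intro x hx u hu v hv
        have huv : u = v := by
          simp only [hN j, Finset.mem_erase, Finset.mem_insert, Finset.mem_singleton] at hx hu hv
          grind
        rw [huv]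
        exact .refl

/-- The collections of 2-connected graphs on disjoint node sets. -/
theorem morseFiltration_isTwoConnCollection [Fintype ι] [Finite U]
    (hN : Pairwise (Function.onFun Disjoint N)) (h2 : ∀ j, 2 ≤ (N j).card) :
    MorseFiltration (∑ j, (2 * (N j).card - 3)) {S | IsTwoConnCollection N S}
      (∏ j, ((N j).card - 2).factorial) := by
  induction hn : ∑ j, (N j).card using Nat.strong_induction_on generalizing N with
  | _ n ih =>
  by_cases hall : ∀ j, (N j).card = 2
  · choose p q hpq hpqN using fun j => Finset.card_eq_two.1 (hall j)
    have hset : {S | IsTwoConnCollection N S} =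
        insert (Finset.univ.image fun j => s(p j, q j)) ∅ := by
      ext S
      simp only [Set.mem_insert_iff, Set.mem_empty_iff_false, or_false]
      exact isTwoConnCollection_iff_of_card_eq_two hpq hpqN
    have hinj : Function.Injective fun j => s(p j, q j) := by
      intro i j hij
      by_contra hne
      exact sym2_ne_of_disjoint (hN (Ne.symm hne)) (by simp [hpqN]) (q j)
        (by simp [hpqN] : p i ∈ N i) (by simp [hpqN] : q i ∈ N i) hij
    rw [hset]
    have := MorseFiltration.crit (k := ∑ j, (2 * (N j).card - 3)) .empty
      (S := Finset.univ.image fun j => s(p j, q j)) (by simp)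
      (by rw [Finset.card_image_of_injective _ hinj]; simp [hall])
    simpa [hall] using this
  · push Not at hall
    obtain ⟨j, hj⟩ := hall
    have hcard : 3 ≤ (N j).card := by
      have := h2 j
      omega
    obtain ⟨a, ha, b, hb, hab⟩ := Finset.one_lt_card.1 (by omega : 1 < (N j).card)
    set N' := Function.update N j ((N j).erase a) with hN'
    have hcj : (N' j).card = (N j).card - 1 := by
      rw [hN', Function.update_self, Finset.card_erase_of_mem ha]
    have hci : ∀ i ≠ j, N' i = N i := fun i hij => by rw [hN', Function.update_of_ne hij]
    have hsub : ∀ i, N' i ⊆ N i := by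
      intro i
      by_cases hij : i = j
      · subst hij
        rw [hN', Function.update_self]
        exact Finset.erase_subset _ _
      · rw [hci i hij]
    have hsumlt : ∑ i, (N' i).card < n := by
      rw [← hn]
      exact Finset.sum_lt_sum (fun i _ => Finset.card_le_card (hsub i))
        ⟨j, Finset.mem_univ _, by omega⟩
    have key := ih _ hsumlt (N := N') (fun i i' hii =>
        Finset.disjoint_of_subset_left (hsub i) (Finset.disjoint_of_subset_right (hsub i') (hN hii)))
      (fun i => by
        by_cases hij : i = j
        · subst hij
          omega
        · rw [hci i hij]
          exact h2 i) rfl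
    have := MorseFiltration.isTwoConnCollection_of_update hN ha hb hab hcard key
    have hsum : ∑ i, (2 * (N i).card - 3) = 2 + ∑ i, (2 * (N' i).card - 3) := by
      rw [← Finset.add_sum_erase _ _ (Finset.mem_univ j),
        ← Finset.add_sum_erase (a := j) _ (fun i => 2 * (N' i).card - 3) (Finset.mem_univ j),
        Finset.sum_congr rfl fun i hi => by rw [← hci i (Finset.ne_of_mem_erase hi)], hcj]
      omega
    have hprod : ∏ i, ((N i).card - 2).factorial =
        ((N j).card - 2) * ∏ i, ((N' i).card - 2).factorial := by
      rw [← Finset.mul_prod_erase _ _ (Finset.mem_univ j),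
        ← Finset.mul_prod_erase (a := j) _ (fun i => ((N' i).card - 2).factorial)
          (Finset.mem_univ j),
        Finset.prod_congr rfl fun i hi => by rw [← hci i (Finset.ne_of_mem_erase hi)], hcj,
        ← mul_assoc]
      congr 1
      obtain ⟨c, hc⟩ := Nat.exists_eq_add_of_le hcard
      rw [hc, show 3 + c - 2 = c + 1 by omega, show 3 + c - 1 - 2 = c by omega,
        Nat.factorial_succ]
    rw [hsum, hprod]
    exact this

end Collections

section Comparison

variable {m : ℕ} {A : Fin m → ℕ}

/-- The nodes of the `j`-th graph inside the disjoint union of all node sets. -/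
def nodeSet (A : Fin m → ℕ) (j : Fin m) : Finset (Σ j : Fin m, Fin (A j)) :=
  Finset.univ.map (Function.Embedding.sigmaMk j)

theorem mk_mem_nodeSet {i j : Fin m} {u : Fin (A i)} :
    (⟨i, u⟩ : Σ j : Fin m, Fin (A j)) ∈ nodeSet A j ↔ i = j := by
  simp only [nodeSet, Finset.mem_map, Finset.mem_univ, true_and]
  constructor
  · rintro ⟨v, hv⟩
    exact (congrArg Sigma.fst hv).symm
  · rintro rfl
    exact ⟨u, rfl⟩

theorem card_nodeSet (j : Fin m) : (nodeSet A j).card = A j := by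
  simp [nodeSet]

theorem pairwise_disjoint_nodeSet : Pairwise (Function.onFun Disjoint (nodeSet A)) := by
  intro i j hij
  refine Finset.disjoint_left.2 ?_
  rintro ⟨l, u⟩ hi hj
  exact hij ((mk_mem_nodeSet.1 hi).symm.trans (mk_mem_nodeSet.1 hj))

theorem mk_sigma_eq_iff {j : Fin m} {u v : Fin (A j)} :
    (⟨j, u⟩ : Σ j : Fin m, Fin (A j)) = ⟨j, v⟩ ↔ u = v :=
  (Function.Embedding.sigmaMk (β := fun j => Fin (A j)) j).injective.eq_iff

/-- The edges of the graphs as unordered pairs of nodes of the disjoint union. -/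
def edgeEmbedding (A : Fin m → ℕ) : VtxE m A ↪ Sym2 (Σ j : Fin m, Fin (A j)) where
  toFun x := s(⟨x.1, x.2.1.1⟩, ⟨x.1, x.2.1.2⟩)
  inj' := by
    rintro ⟨i, ⟨u, v⟩, huv⟩ ⟨j, ⟨u', v'⟩, huv'⟩ h
    have hij : i = j := by
      rcases Sym2.eq_iff.1 h with ⟨h, -⟩ | ⟨h, -⟩ <;> exact congrArg Sigma.fst h
    subst hij
    rcases Sym2.eq_iff.1 h with ⟨h, h'⟩ | ⟨h, h'⟩
    · obtain rfl := mk_sigma_eq_iff.1 h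
      obtain rfl := mk_sigma_eq_iff.1 h'
      rfl
    · obtain rfl := mk_sigma_eq_iff.1 h
      obtain rfl := mk_sigma_eq_iff.1 h'
      exact absurd huv huv'.asymm

theorem edgeEmbedding_apply (x : VtxE m A) :
    edgeEmbedding A x = s(⟨x.1, x.2.1.1⟩, ⟨x.1, x.2.1.2⟩) := rfl

theorem exists_edgeEmbedding_eq {j : Fin m} {u v : Fin (A j)} (huv : u ≠ v) :
    ∃ e : Edge (A j), edgeEmbedding A ⟨j, e⟩ = s(⟨j, u⟩, ⟨j, v⟩) ∧ s(u, v) = s(e.1.1, e.1.2) := by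
  rcases huv.lt_or_gt with h | h
  · exact ⟨⟨(u, v), h⟩, rfl, rfl⟩
  · exact ⟨⟨(v, u), h⟩, Sym2.eq_swap, Sym2.eq_swap⟩

theorem exists_map_edgeEmbedding_eq {S : Finset (Sym2 (Σ j : Fin m, Fin (A j)))}
    (hS : IsTwoConnCollection (nodeSet A) S) :
    ∃ S' : Finset (VtxE m A), S'.map (edgeEmbedding A) = S := by
  classical
  refine ⟨Finset.univ.filter fun x => edgeEmbedding A x ∈ S, ?_⟩
  ext e
  simp only [Finset.mem_map, Finset.mem_filter, Finset.mem_univ, true_and]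
  constructor
  · rintro ⟨x, hx, rfl⟩
    exact hx
  · intro he
    obtain ⟨j, ⟨i, u⟩, hu, ⟨l, v⟩, hv, huv, rfl⟩ := hS.1 e he
    obtain rfl := mk_mem_nodeSet.1 hu
    obtain rfl := mk_mem_nodeSet.1 hv
    obtain ⟨e, he', -⟩ := exists_edgeEmbedding_eq fun h => huv (mk_sigma_eq_iff.2 h)
    exact ⟨_, he' ▸ he, he'⟩

theorem grOf_adj {S : Finset (VtxE m A)} {j : Fin m} {u v : Fin (A j)} :
    (grOf m A S j).Adj u v ↔
      s((⟨j, u⟩ : Σ j : Fin m, Fin (A j)), ⟨j, v⟩) ∈ S.map (edgeEmbedding A) := by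
  rw [grOf, SimpleGraph.fromEdgeSet_adj, Finset.mem_map]
  constructor
  · rintro ⟨⟨e, he, h⟩, -⟩
    refine ⟨_, he, ?_⟩
    rcases Sym2.eq_iff.1 h with ⟨rfl, rfl⟩ | ⟨rfl, rfl⟩
    · rfl
    · exact Sym2.eq_swap
  · rintro ⟨⟨i, e⟩, he, h⟩
    have huv : u ≠ v := by
      rintro rfl
      have h1 : (edgeEmbedding A ⟨i, e⟩).IsDiag := by
        rw [h]
        exact Sym2.mk_isDiag_iff.2 rfl
      rw [edgeEmbedding_apply, Sym2.mk_isDiag_iff] at h1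
      exact e.2.ne (mk_sigma_eq_iff.1 h1)
    obtain ⟨e', he', hs⟩ := exists_edgeEmbedding_eq huv
    have := (edgeEmbedding A).injective (h.trans he'.symm)
    exact ⟨⟨e', this ▸ he, hs⟩, huv⟩

/-- Connectedness of the graph induced on a set of nodes in terms of chains of edges. -/
theorem induce_grOf_preconnected_iff {S : Finset (VtxE m A)} {j : Fin m} {W : Set (Fin (A j))}
    {M : Finset (Σ j : Fin m, Fin (A j))} (hM : M ⊆ nodeSet A j)
    (hW : ∀ u, (⟨j, u⟩ : Σ j : Fin m, Fin (A j)) ∈ M ↔ u ∈ W) :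
    ((grOf m A S j).induce W).Preconnected ↔
      ∀ u ∈ M, ∀ v ∈ M, Reach (S.map (edgeEmbedding A)) M u v := by
  constructor
  · rintro h ⟨i, u⟩ hu ⟨l, v⟩ hv
    obtain rfl := mk_mem_nodeSet.1 (hM hu)
    obtain rfl := mk_mem_nodeSet.1 (hM hv)
    have := (SimpleGraph.reachable_iff_reflTransGen _ _).1
      (h ⟨u, (hW u).1 hu⟩ ⟨v, (hW v).1 hv⟩)
    refine this.lift (fun x : W => (⟨_, x.1⟩ : Σ j : Fin m, Fin (A j))) fun x y hxy => ?_
    exact ⟨grOf_adj.1 hxy, (hW _).2 x.2, (hW _).2 y.2⟩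
  · rintro h ⟨u, hu⟩ ⟨v, hv⟩
    have key : ∀ y, Reach (S.map (edgeEmbedding A)) M ⟨j, u⟩ y →
        ∃ v, ∃ hv : v ∈ W, y = ⟨j, v⟩ ∧
          ((grOf m A S j).induce W).Reachable ⟨u, hu⟩ ⟨v, hv⟩ := by
      intro y hy
      induction hy with
      | refl => exact ⟨u, hu, rfl, .rfl⟩
      | @tail y z _ hstep ih =>
        obtain ⟨v, hv, rfl, hr⟩ := ih
        obtain ⟨l, w⟩ := z
        obtain rfl := mk_mem_nodeSet.1 (hM hstep.2.2)
        have hw := (hW w).1 hstep.2.2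
        refine ⟨w, hw, rfl, hr.trans (SimpleGraph.Adj.reachable ?_)⟩
        exact grOf_adj.2 hstep.1
    obtain ⟨v', hv', he, hr⟩ := key _ (h _ ((hW u).2 hu) _ ((hW v).2 hv))
    obtain rfl := mk_sigma_eq_iff.1 he
    exact hr

theorem exists_nodes_of_mem_map_edgeEmbedding {S : Finset (VtxE m A)} :
    ∀ e ∈ S.map (edgeEmbedding A), ∃ j, ∃ u ∈ nodeSet A j, ∃ v ∈ nodeSet A j,
      u ≠ v ∧ e = s(u, v) := by
  intro e he
  obtain ⟨⟨j, e⟩, -, rfl⟩ := Finset.mem_map.1 he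
  exact ⟨j, _, mk_mem_nodeSet.2 rfl, _, mk_mem_nodeSet.2 rfl,
    fun h => e.2.ne (mk_sigma_eq_iff.1 h), rfl⟩

theorem isTwoConnCollection_map_iff (hA : ∀ j, 2 ≤ A j) {S : Finset (VtxE m A)} :
    IsTwoConnCollection (nodeSet A) (S.map (edgeEmbedding A)) ↔ goodTwoConn m A S := by
  rw [IsTwoConnCollection, and_iff_right exists_nodes_of_mem_map_edgeEmbedding, goodTwoConn]
  refine forall_congr' fun j => and_congr ?_ ?_
  · rw [← SimpleGraph.induceUnivIso (grOf m A S j) |>.connected_iff, SimpleGraph.connected_iff,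
      induce_grOf_preconnected_iff subset_rfl fun u => by simp [mk_mem_nodeSet]]
    have : Nonempty (Fin (A j)) := ⟨⟨0, by have := hA j; omega⟩⟩
    exact (and_iff_left (by simp)).symm
  · constructor
    · intro h v
      have : Nontrivial (Fin (A j)) := Fin.nontrivial_iff_two_le.2 (hA j)
      obtain ⟨w, hw⟩ := exists_ne v
      refine (SimpleGraph.connected_iff _).2 ⟨?_, ⟨w, hw⟩⟩
      refine (induce_grOf_preconnected_iff (Finset.erase_subset ⟨j, v⟩ _) fun u => ?_).2
        (h ⟨j, v⟩ (mk_mem_nodeSet.2 rfl))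
      simp [mk_mem_nodeSet]
    · rintro h ⟨i, v⟩ hv
      obtain rfl := mk_mem_nodeSet.1 hv
      refine (induce_grOf_preconnected_iff (Finset.erase_subset _ _) fun u => ?_).1 (h v).1
      simp [mk_mem_nodeSet]

theorem isUpperSet_goodTwoConn (hA : ∀ j, 2 ≤ A j) : IsUpperSet {S | goodTwoConn m A S} := by
  intro S T hST hS
  rw [Set.mem_ofPred_eq, ← isTwoConnCollection_map_iff hA] at hS ⊢
  exact ⟨exists_nodes_of_mem_map_edgeEmbedding,
    fun j => (hS.2 j).mono (Finset.map_subset_map.2 hST)⟩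

theorem not_goodTwoConn_empty (hm : 1 ≤ m) (hA : ∀ j, 2 ≤ A j) : ¬ goodTwoConn m A ∅ := by
  intro h
  have hc := (h ⟨0, hm⟩).1
  have : Nontrivial (Fin (A ⟨0, hm⟩)) := Fin.nontrivial_iff_two_le.2 (hA _)
  obtain ⟨v, hv⟩ := hc.preconnected.exists_adj_of_nontrivial ⟨0, by have := hA ⟨0, hm⟩; omega⟩
  simpa using grOf_adj.1 hv

theorem sum_two_mul_sub_three (hA : ∀ j, 2 ≤ A j) :
    ∑ j, (2 * A j - 3) + 3 * m = 2 * ∑ j, A j := by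
  have h : ∑ j, (2 * A j - 3) + ∑ _j : Fin m, 3 = ∑ j, 2 * A j := by
    rw [← Finset.sum_add_distrib]
    refine Finset.sum_congr rfl fun j _ => ?_
    have := hA j
    omega
  rw [Finset.mul_sum, ← h]
  simp [mul_comm]

end Comparison

/-- Let `A = (a₁,…,a_m)` with `m ≥ 1` and each `a_j ≥ 2`.
For any linear order on the vertex set, the homology of the quotient complex
of collections of 2-connected graphs vanishes in every degree other than
`2|A| − 3m − 1`, and in that degree it is free abelian of rank
`(a₁−2)!⋯(a_m−2)!`. -/
theorem homology_two_connected_collection_complex (m : ℕ) (A : Fin m → ℕ)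
    (hm : 1 ≤ m) (hA : ∀ j, 2 ≤ A j) [LinearOrder (VtxE m A)] :
    (∀ d : ℕ, d ≠ 2 * (∑ j, A j) - 3 * m - 1 →
      Subsingleton (homology (VtxE m A) (goodTwoConn m A) d)) ∧
    Nonempty (homology (VtxE m A) (goodTwoConn m A) (2 * (∑ j, A j) - 3 * m - 1) ≃ₗ[ℤ]
      (Fin (∏ j, Nat.factorial (A j - 2)) → ℤ)) := by
  have hM := (morseFiltration_isTwoConnCollection (pairwise_disjoint_nodeSet (A := A))
    fun j => (hA j).trans_eq (card_nodeSet j).symm).preimage_map (edgeEmbedding A)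
    fun S hS => exists_map_edgeEmbedding_eq hS
  simp only [Set.mem_ofPred_eq, isTwoConnCollection_map_iff hA, card_nodeSet] at hM
  have hpos : m ≤ ∑ j, (2 * A j - 3) := by
    calc m = ∑ _j : Fin m, 1 := by simp
      _ ≤ ∑ j, (2 * A j - 3) := Finset.sum_le_sum fun j _ => by
        have := hA j
        omega
  have hsum := sum_two_mul_sub_three hA
  obtain ⟨k, hk⟩ : ∃ k, ∑ j, (2 * A j - 3) = k + 1 := ⟨_, (Nat.sub_add_cancel (by omega)).symm⟩
  have hdeg : 2 * (∑ j, A j) - 3 * m - 1 = k := by omega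
  rw [hk] at hM
  rw [hdeg]
  have hS : IsSpherical {S | goodTwoConn m A S} (k + 1) (∏ j, Nat.factorial (A j - 2)) :=
    MorseFiltration.isSpherical (by convert hM) (isUpperSet_goodTwoConn hA)
  exact hS.homology (not_goodTwoConn_empty hm hA)

end
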